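/- Let G = W(H4) ⊂ GL₄(ℝ) be the Weyl group of type H4 (generated by the four explicit matrices below). The real vector space of G-invariant homogeneous polynomials of degree 36 in ℝ[x,y,z,w] that vanish to order at least 10 at the point (0,0,0,1) (i.e., lie in the ideal (x,y,z)^{10}) is one-dimensional. -/

import Mathlib

open MvPolynomial Matrix

/-- The golden ratio. -/
noncomputable def gr : ℝ := (1 + Real.sqrt 5) / 2

/-- The first generator of `W(H4)`: `diag(−1,1,1,1)`. -/
def m1 : Matrix (Fin 4) (Fin 4) ℝ :=
  ![![-1, 0, 0, 0], ![0, 1, 0, 0], ![0, 0, 1, 0], ![0, 0, 0, 1]]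

/-- The second generator of `W(H4)`: `diag(1,−1,1,1)`. -/
def m2 : Matrix (Fin 4) (Fin 4) ℝ :=
  ![![1, 0, 0, 0], ![0, -1, 0, 0], ![0, 0, 1, 0], ![0, 0, 0, 1]]

/-- The third generator of `W(H4)`:
`(1/2)·[[φ, φ−1, −1, 0], [φ−1, 1, φ, 0], [−1, φ, 1−φ, 0], [0, 0, 0, 2]]`. -/
noncomputable def m3 : Matrix (Fin 4) (Fin 4) ℝ :=
  (1 / 2 : ℝ) • ![![gr, gr - 1, -1, 0], ![gr - 1, 1, gr, 0],
    ![-1, gr, 1 - gr, 0], ![0, 0, 0, 2]]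

/-- The fourth generator of `W(H4)`. -/
def m4 : Matrix (Fin 4) (Fin 4) ℝ :=
  ![![0, 0, -1, 0], ![0, 0, 0, 1], ![1, 0, 0, 0], ![0, -1, 0, 0]]

/-- The Weyl group `W(H4) ≤ GL₄(ℝ)`, generated by the four matrices above. -/
noncomputable def WH4 : Subgroup (GL (Fin 4) ℝ) :=
  Subgroup.closure { g : GL (Fin 4) ℝ |
    (↑g : Matrix (Fin 4) (Fin 4) ℝ) = m1 ∨ (↑g : Matrix (Fin 4) (Fin 4) ℝ) = m2 ∨
    (↑g : Matrix (Fin 4) (Fin 4) ℝ) = m3 ∨ (↑g : Matrix (Fin 4) (Fin 4) ℝ) = m4 }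

/-- The action of `g ∈ GL₄(ℝ)` on polynomials by linear change of variables:
`(g · F)(v) = F(g⁻¹ v)`. -/
noncomputable def polyActR (g : GL (Fin 4) ℝ) (F : MvPolynomial (Fin 4) ℝ) :
    MvPolynomial (Fin 4) ℝ :=
  aeval (fun i : Fin 4 =>
    ∑ j : Fin 4, ((↑(g⁻¹) : Matrix (Fin 4) (Fin 4) ℝ) i j) • (X j : MvPolynomial (Fin 4) ℝ)) F

/-! ### Linear substitutions and invariance -/

/-- Matrix acting on a vector with entries in an `ℝ`-algebra. -/
noncomputable def act {R : Type*} [CommRing R] [Algebra ℝ R] (m : Matrix (Fin 4) (Fin 4) ℝ)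
    (v : Fin 4 → R) : Fin 4 → R := fun i => ∑ j, m i j • v j

/-- The linear form with coefficients `α` evaluated at `v`. -/
noncomputable def lin {R : Type*} [CommRing R] [Algebra ℝ R] (α : Fin 4 → ℝ)
    (v : Fin 4 → R) : R := ∑ i, α i • v i

/-- The generators. -/
def IsGen (m : Matrix (Fin 4) (Fin 4) ℝ) : Prop := m = m1 ∨ m = m2 ∨ m = m3 ∨ m = m4

/-- Invariance under the four generators. -/
def GInv (D : MvPolynomial (Fin 4) ℝ) : Prop := ∀ m, IsGen m → aeval (act m X) D = D

lemma polyActR_eq (g : GL (Fin 4) ℝ) (F : MvPolynomial (Fin 4) ℝ) :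
    polyActR g F = aeval (act (↑(g⁻¹) : Matrix (Fin 4) (Fin 4) ℝ) X) F := rfl

lemma aeval_act {R : Type*} [CommRing R] [Algebra ℝ R] (m : Matrix (Fin 4) (Fin 4) ℝ)
    (v : Fin 4 → R) (D : MvPolynomial (Fin 4) ℝ) :
    aeval (act m v) D = aeval v (aeval (act m (X : Fin 4 → MvPolynomial (Fin 4) ℝ)) D) := by
  have : (aeval (act m v) : MvPolynomial (Fin 4) ℝ →ₐ[ℝ] R) =
      (aeval v).comp (aeval (act m (X : Fin 4 → MvPolynomial (Fin 4) ℝ))) := by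
    ext i
    simp [act]
  rw [this]; rfl

lemma act_act {R : Type*} [CommRing R] [Algebra ℝ R] (m n : Matrix (Fin 4) (Fin 4) ℝ)
    (v : Fin 4 → R) : act m (act n v) = act (m * n) v := by
  ext i
  simp only [act, Matrix.mul_apply, Finset.smul_sum, Finset.sum_smul, smul_smul]
  rw [Finset.sum_comm]

lemma act_one {R : Type*} [CommRing R] [Algebra ℝ R] (v : Fin 4 → R) :
    act 1 v = v := by
  ext i
  simp [act, Matrix.one_apply]

lemma GInv.apply {D : MvPolynomial (Fin 4) ℝ} (h : GInv D) {m : Matrix (Fin 4) (Fin 4) ℝ}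
    (hm : IsGen m) {R : Type*} [CommRing R] [Algebra ℝ R] (v : Fin 4 → R) :
    aeval (act m v) D = aeval v D := by
  rw [aeval_act, h m hm]

lemma polyActR_mul (g h : GL (Fin 4) ℝ) (F : MvPolynomial (Fin 4) ℝ) :
    polyActR (g * h) F = polyActR g (polyActR h F) := by
  simp only [polyActR_eq]
  rw [← aeval_act, act_act, _root_.mul_inv_rev]
  rfl

lemma polyActR_one (F : MvPolynomial (Fin 4) ℝ) : polyActR 1 F = F := by
  simp only [polyActR_eq, inv_one]
  rw [Units.val_one, act_one]
  simp

lemma GInv.invariant {F : MvPolynomial (Fin 4) ℝ} (h : GInv F) :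
    ∀ g ∈ WH4, polyActR g F = F := by
  intro g hg
  unfold WH4 at hg
  induction hg using Subgroup.closure_induction with
  | mem x hx =>
    have h1 : polyActR x⁻¹ F = F := by
      rw [polyActR_eq, inv_inv]
      exact h _ hx
    conv_lhs => rw [← h1]
    rw [← polyActR_mul, mul_inv_cancel, polyActR_one]
  | one => exact polyActR_one F
  | mul x y _ _ hx hy => rw [polyActR_mul, hy, hx]
  | inv x _ hx =>
    conv_lhs => rw [← hx]
    rw [← polyActR_mul, inv_mul_cancel, polyActR_one]

lemma gr_sq : gr ^ 2 = gr + 1 := by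
  unfold gr
  have := Real.sq_sqrt (show (0 : ℝ) ≤ 5 by norm_num)
  nlinarith

lemma m1_sq : m1 * m1 = 1 := by
  ext i j
  rw [Matrix.mul_apply, Fin.sum_univ_four]
  fin_cases i <;> fin_cases j <;> simp [m1]

lemma m2_sq : m2 * m2 = 1 := by
  ext i j
  rw [Matrix.mul_apply, Fin.sum_univ_four]
  fin_cases i <;> fin_cases j <;> simp [m2]

lemma m3_sq : m3 * m3 = 1 := by
  have h := gr_sq
  ext i j
  rw [Matrix.mul_apply, Fin.sum_univ_four]
  fin_cases i <;> fin_cases j <;> simp [m3] <;> grind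

lemma m4_sq : m4 * m4 = -1 := by
  ext i j
  rw [Matrix.mul_apply, Fin.sum_univ_four, Matrix.neg_apply]
  fin_cases i <;> fin_cases j <;> simp [m4]

lemma m1_tr : m1ᵀ = m1 := by
  ext i j
  rw [Matrix.transpose_apply]
  fin_cases i <;> fin_cases j <;> simp [m1]

lemma m2_tr : m2ᵀ = m2 := by
  ext i j
  rw [Matrix.transpose_apply]
  fin_cases i <;> fin_cases j <;> simp [m2]

lemma m3_tr : m3ᵀ = m3 := by
  ext i j
  rw [Matrix.transpose_apply]
  fin_cases i <;> fin_cases j <;> simp [m3]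

lemma m4_tr : m4ᵀ = -m4 := by
  ext i j
  rw [Matrix.transpose_apply, Matrix.neg_apply]
  fin_cases i <;> fin_cases j <;> simp [m4]

lemma gen_inv {m : Matrix (Fin 4) (Fin 4) ℝ} (hm : IsGen m) : ∃ n, n * m = 1 ∧ m * n = 1 := by
  rcases hm with rfl | rfl | rfl | rfl
  · exact ⟨m1, m1_sq, m1_sq⟩
  · exact ⟨m2, m2_sq, m2_sq⟩
  · exact ⟨m3, m3_sq, m3_sq⟩
  · exact ⟨-m4, by simp [m4_sq], by simp [m4_sq]⟩

lemma GInv.of_invariant {F : MvPolynomial (Fin 4) ℝ} (h : ∀ g ∈ WH4, polyActR g F = F) :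
    GInv F := by
  intro m hm
  obtain ⟨n, h1, h2⟩ := gen_inv hm
  let g : GL (Fin 4) ℝ := ⟨m, n, h2, h1⟩
  have hg : g ∈ WH4 := Subgroup.subset_closure hm
  have := h g⁻¹ (inv_mem hg)
  rwa [polyActR_eq, inv_inv] at this

/-! ### Powers of linear forms dividing a polynomial -/

lemma form_irreducible {σ : Type*} [Fintype σ] (a : σ → ℝ) (ha : a ≠ 0) :
    Irreducible (∑ i, a i • (X i : MvPolynomial σ ℝ)) := by
  classical
  obtain ⟨k, hk⟩ := Function.ne_iff.mp ha
  have hc : coeff (Finsupp.single k 1) (∑ i, a i • (X i : MvPolynomial σ ℝ)) = a k := by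
    rw [coeff_sum]
    simp [coeff_X, Finsupp.single_left_inj]
  have hne : (∑ i, a i • (X i : MvPolynomial σ ℝ)) ≠ 0 := by
    intro h
    rw [h] at hc
    exact hk (by simpa using hc.symm)
  have hh : (∑ i, a i • (X i : MvPolynomial σ ℝ)).IsHomogeneous 1 := by
    apply IsHomogeneous.sum
    intro i _
    rw [smul_eq_C_mul]
    simpa using (isHomogeneous_C σ (a i)).mul (isHomogeneous_X ℝ i)
  apply irreducible_of_totalDegree_eq_one (hh.totalDegree hne)
  intro x hx
  have := hx (Finsupp.single k 1)
  rw [hc] at this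
  refine isUnit_iff_ne_zero.mpr ?_
  rintro rfl
  exact hk (by simpa using this)

lemma eq_zero_of_forms_dvd {σ ι : Type*} [Fintype σ] [Fintype ι] (a : ι → σ → ℝ)
    (e : ι → ℕ) (P : MvPolynomial σ ℝ) (N : ℕ) (hP : P.totalDegree ≤ N)
    (hN : N < ∑ i, e i) (ha : ∀ i, a i ≠ 0)
    (hpair : Pairwise fun i j => ∃ k l, a i k * a j l ≠ a i l * a j k)
    (hdvd : ∀ i, (∑ k, a i k • (X k : MvPolynomial σ ℝ)) ^ e i ∣ P) : P = 0 := by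
  classical
  by_contra hP0
  have hd : ∏ i, (∑ k, a i k • (X k : MvPolynomial σ ℝ)) ^ e i ∣ P := by
    apply Finset.prod_dvd_of_isRelPrime
    · intro i _ j _ hij
      apply IsRelPrime.pow
      rw [(form_irreducible _ (ha i)).isRelPrime_iff_not_dvd]
      rintro ⟨q, hq⟩
      obtain ⟨k, l, hkl⟩ := hpair hij
      have hkl' : k ≠ l := by rintro rfl; exact hkl rfl
      have h := congrArg (eval (fun t => if t = k then a i l else if t = l then - a i k else 0)) hq
      have key : ∀ b : σ → ℝ, eval (fun t => if t = k then a i l else if t = l then - a i k else 0)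
          (∑ t, b t • (X t : MvPolynomial σ ℝ)) = b k * a i l - b l * a i k := by
        intro b
        rw [map_sum]
        simp only [smul_eval, eval_X]
        rw [Finset.sum_eq_add k l hkl']
        · simp [hkl'.symm]; ring
        · intro c _ hc; simp [hc.1, hc.2]
        · simp
        · simp
      rw [map_mul, key, key] at h
      apply hkl
      linarith
    · intro i _; exact hdvd i
  obtain ⟨q, hq⟩ := hd
  have hq0 : q ≠ 0 := by rintro rfl; simp at hq; exact hP0 hq
  have hp0 : ∏ i, (∑ k, a i k • (X k : MvPolynomial σ ℝ)) ^ e i ≠ 0 := by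
    intro h; rw [h, zero_mul] at hq; exact hP0 hq
  have hh : (∏ i, (∑ k, a i k • (X k : MvPolynomial σ ℝ)) ^ e i).IsHomogeneous (∑ i, e i) := by
    apply IsHomogeneous.prod
    intro i _
    have : (∑ k, a i k • (X k : MvPolynomial σ ℝ)).IsHomogeneous 1 := by
      apply IsHomogeneous.sum
      intro k _
      rw [smul_eq_C_mul]
      simpa using (isHomogeneous_C σ (a i k)).mul (isHomogeneous_X ℝ k)
    simpa using this.pow (e i)
  rw [hq, totalDegree_mul_of_isDomain hp0 hq0, hh.totalDegree hp0] at hP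
  omega

/-! ### A univariate Bezout lemma -/

lemma poly_eq_zero_of_roots {ι : Type*} [Fintype ι] (r : ι → ℝ) (hr : Function.Injective r)
    (e : ι → ℕ) (f : Polynomial ℝ) (N : ℕ) (hf : f.natDegree ≤ N) (hN : N < ∑ i, e i)
    (hd : ∀ i, (Polynomial.X - Polynomial.C (r i)) ^ e i ∣ f) : f = 0 := by
  by_contra hf0
  have hd : ∏ i, (Polynomial.X - Polynomial.C (r i)) ^ e i ∣ f := by
    apply Fintype.prod_dvd_of_coprime
    · intro i j hij
      exact (Polynomial.isCoprime_X_sub_C_of_isUnit_sub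
        (isUnit_iff_ne_zero.mpr (sub_ne_zero.mpr (hr.ne hij)))).pow
    · exact hd
  have h1 := Polynomial.natDegree_le_of_dvd hd hf0
  rw [Polynomial.natDegree_prod_of_monic _ _
    (fun i _ => (Polynomial.monic_X_sub_C (r i)).pow (e i))] at h1
  simp only [Polynomial.natDegree_pow, Polynomial.natDegree_X_sub_C, mul_one] at h1
  omega

/-! ### Orbits of roots over `ℤ[φ]` -/

/-- The `g`-th generator. -/
noncomputable def gen (g : Fin 4) : Matrix (Fin 4) (Fin 4) ℝ := ![m1, m2, m3, m4] g

lemma isGen_gen (g : Fin 4) : IsGen (gen g) := by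
  fin_cases g <;> simp [gen, IsGen]

/-- The real number `a + b φ`. -/
noncomputable def toR (a : ℤ × ℤ) : ℝ := a.1 + a.2 * gr

/-- Product in `ℤ[φ]`. -/
def zmul (a b : ℤ × ℤ) : ℤ × ℤ := (a.1 * b.1 + a.2 * b.2, a.1 * b.2 + a.2 * b.1 + a.2 * b.2)

lemma toR_mul (a b : ℤ × ℤ) : toR (zmul a b) = toR a * toR b := by
  have := gr_sq
  simp only [toR, zmul]
  push_cast
  grind

lemma toR_add (a b : ℤ × ℤ) : toR (a + b) = toR a + toR b := by
  simp only [toR, Prod.fst_add, Prod.snd_add]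
  push_cast
  ring

lemma toR_inj : Function.Injective toR := by
  intro a b h
  have hirr : Irrational gr := Real.goldenRatio_irrational
  simp only [toR] at h
  have h2 : a.2 = b.2 := by
    by_contra hne
    have hne' : ((a.2 - b.2 : ℤ) : ℝ) ≠ 0 := by exact_mod_cast sub_ne_zero.mpr hne
    apply hirr
    refine ⟨((b.1 - a.1 : ℤ) : ℚ) / ((a.2 - b.2 : ℤ) : ℚ), ?_⟩
    push_cast at hne' ⊢
    rw [div_eq_iff hne']
    linarith
  rw [h2] at h
  have h1 : (a.1 : ℝ) = b.1 := by linarith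
  exact Prod.ext (by exact_mod_cast h1) h2

/-- Vectors over `ℤ[φ]`. -/
structure V4 where
  /-- first coordinate -/
  x : ℤ × ℤ
  /-- second coordinate -/
  y : ℤ × ℤ
  /-- third coordinate -/
  z : ℤ × ℤ
  /-- fourth coordinate -/
  w : ℤ × ℤ

instance : DecidableEq V4 := fun a b =>
  decidable_of_iff (a.x = b.x ∧ a.y = b.y ∧ a.z = b.z ∧ a.w = b.w) (by
    cases a; cases b; simp)

/-- The real vector of a `V4`. -/
noncomputable def V4.toV (v : V4) : Fin 4 → ℝ := ![toR v.x, toR v.y, toR v.z, toR v.w]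

/-- Scaling. -/
def V4.scale (c : ℤ × ℤ) (v : V4) : V4 := ⟨zmul c v.x, zmul c v.y, zmul c v.z, zmul c v.w⟩

lemma V4.toV_scale (c : ℤ × ℤ) (v : V4) : (v.scale c).toV = toR c • v.toV := by
  ext i
  fin_cases i <;> simp [V4.toV, V4.scale, toR_mul]

/-- Twice the `g`-th generator acting on vectors over `ℤ[φ]`. -/
def zact (g : Fin 4) (v : V4) : V4 :=
  match g with
  | 0 => ⟨zmul (-2, 0) v.x, zmul (2, 0) v.y, zmul (2, 0) v.z, zmul (2, 0) v.w⟩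
  | 1 => ⟨zmul (2, 0) v.x, zmul (-2, 0) v.y, zmul (2, 0) v.z, zmul (2, 0) v.w⟩
  | 2 => ⟨zmul (0, 1) v.x + zmul (-1, 1) v.y + zmul (-1, 0) v.z,
      zmul (-1, 1) v.x + v.y + zmul (0, 1) v.z,
      zmul (-1, 0) v.x + zmul (0, 1) v.y + zmul (1, -1) v.z, zmul (2, 0) v.w⟩
  | 3 => ⟨zmul (-2, 0) v.z, zmul (2, 0) v.w, zmul (2, 0) v.x, zmul (-2, 0) v.y⟩

lemma zact_toV (g : Fin 4) (v : V4) : (zact g v).toV = (2 : ℝ) • act (gen g) v.toV := by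
  ext i
  fin_cases g <;> fin_cases i <;>
    simp [V4.toV, zact, toR_mul, toR_add, act, gen, m1, m2, m3, m4, Fin.sum_univ_four] <;>
    simp [toR] <;> ring

/-- Apply a word in the generators (scaled by a power of two). -/
def zword (w : List (Fin 4)) (v : V4) : V4 := w.foldr zact v

lemma orbit_word (S : (Fin 4 → ℝ) → Prop) (hs : ∀ c : ℝ, c ≠ 0 → ∀ β, S β → S (c • β))
    (w : List (Fin 4)) (hg : ∀ g ∈ w, ∀ β, S β → S (act (gen g) β)) (v : V4) (hv : S v.toV) :
    S (zword w v).toV := by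
  induction w with
  | nil => exact hv
  | cons g w ih =>
    have h1 := ih (fun g' hg' => hg g' (List.mem_cons_of_mem _ hg'))
    have h2 := hs 2 two_ne_zero _ (hg g List.mem_cons_self _ h1)
    rwa [← zact_toV] at h2

lemma orbit_to (S : (Fin 4 → ℝ) → Prop) (hs : ∀ c : ℝ, c ≠ 0 → ∀ β, S β → S (c • β))
    (w : List (Fin 4)) (hg : ∀ g ∈ w, ∀ β, S β → S (act (gen g) β)) (v t : V4) (hv : S v.toV)
    (c d : ℤ × ℤ) (hd : d ≠ 0) (hc : c ≠ 0) (h : (zword w v).scale d = t.scale c) : S t.toV := by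
  have h0 : ∀ c : ℤ × ℤ, c ≠ 0 → toR c ≠ 0 := by
    intro c hc h
    exact hc (toR_inj (by rw [h]; simp [toR]))
  have h1 := hs (toR d) (h0 d hd) _ (orbit_word S hs w hg v hv)
  rw [← V4.toV_scale, h, V4.toV_scale] at h1
  have h2 := hs (toR c)⁻¹ (inv_ne_zero (h0 c hc)) _ h1
  rwa [smul_smul, inv_mul_cancel₀ (h0 c hc), one_smul] at h2

/-! ### Transport of divisibility and of vanishing -/

lemma lin_act {R : Type*} [CommRing R] [Algebra ℝ R] (m : Matrix (Fin 4) (Fin 4) ℝ)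
    (α : Fin 4 → ℝ) (v : Fin 4 → R) : lin α (act m v) = lin (act mᵀ α) v := by
  simp only [lin, act, Matrix.transpose_apply, Finset.smul_sum, Finset.sum_smul, smul_smul,
    smul_eq_mul]
  rw [Finset.sum_comm]
  simp only [mul_comm]

lemma lin_smul {R : Type*} [CommRing R] [Algebra ℝ R] (c : ℝ)
    (α : Fin 4 → ℝ) (v : Fin 4 → R) : lin (c • α) v = c • lin α v := by
  simp [lin, Finset.smul_sum, smul_smul]

lemma lin_map {R : Type*} [CommRing R] [Algebra ℝ R] (σ : R →ₐ[ℝ] R)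
    (α : Fin 4 → ℝ) (v : Fin 4 → R) : σ (lin α v) = lin α (fun i => σ (v i)) := by
  simp [lin]

lemma aeval_map {R : Type*} [CommRing R] [Algebra ℝ R] (σ : R →ₐ[ℝ] R)
    (v : Fin 4 → R) (D : MvPolynomial (Fin 4) ℝ) :
    σ (aeval v D) = aeval (fun i => σ (v i)) D := by
  have : (σ.comp (aeval v) : MvPolynomial (Fin 4) ℝ →ₐ[ℝ] R) = aeval (fun i => σ (v i)) := by
    ext i
    simp
  rw [← this]; rfl

lemma smul_pow_dvd {R : Type*} [CommRing R] [Algebra ℝ R] {c : ℝ} (hc : c ≠ 0) {p q : R} {e : ℕ}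
    (h : p ^ e ∣ q) : (c • p) ^ e ∣ q := by
  obtain ⟨t, rfl⟩ := h
  refine ⟨(c⁻¹) ^ e • t, ?_⟩
  rw [smul_pow, smul_mul_smul_comm, ← mul_pow, mul_inv_cancel₀ hc, one_pow, one_smul]

lemma dvd_transport {D : MvPolynomial (Fin 4) ℝ} (hD : GInv D) {R : Type*} [CommRing R]
    [Algebra ℝ R] (v : Fin 4 → R) (e : ℕ) (g : Fin 4) (σ : R →ₐ[ℝ] R)
    (hσ : ∀ i, σ (v i) = act (gen g) v i) (α : Fin 4 → ℝ) (h : lin α v ^ e ∣ aeval v D) :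
    lin (act (gen g) α) v ^ e ∣ aeval v D := by
  have h1 := map_dvd σ h
  rw [map_pow, lin_map, aeval_map, funext hσ, hD.apply (isGen_gen g), lin_act] at h1
  fin_cases g
  · simpa [gen, m1_tr] using h1
  · simpa [gen, m2_tr] using h1
  · simpa [gen, m3_tr] using h1
  · have h2 := smul_pow_dvd (c := -1) (by norm_num) h1
    rw [← lin_smul] at h2
    have : (-1 : ℝ) • act (gen 3)ᵀ α = act (gen 3) α := by
      simp only [gen]
      change (-1 : ℝ) • act m4ᵀ α = act m4 α
      rw [m4_tr]
      ext i
      simp [act]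
    change lin (act (gen 3) α) v ^ e ∣ _
    rw [← this]
    exact h2

/-- `D` vanishes to order 10 at the projective point `β`. -/
def PB (D : MvPolynomial (Fin 4) ℝ) (β : Fin 4 → ℝ) : Prop :=
  ∀ (R : Type) [CommRing R] [Algebra ℝ R] (J : Ideal R) (v : Fin 4 → R),
    (∀ i j, β j • v i - β i • v j ∈ J) → aeval v D ∈ J ^ 10

lemma PB_smul (D : MvPolynomial (Fin 4) ℝ) (c : ℝ) (hc : c ≠ 0) (β : Fin 4 → ℝ)
    (h : PB D β) : PB D (c • β) := by
  intro R _ _ J v hv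
  apply h R J v
  intro i j
  have h1 := Submodule.smul_of_tower_mem J c⁻¹ (hv i j)
  simpa [smul_sub, smul_smul, hc] using h1

lemma PB_act {D : MvPolynomial (Fin 4) ℝ} (hD : GInv D) (g : Fin 4) (β : Fin 4 → ℝ)
    (h : PB D β) : PB D (act (gen g) β) := by
  intro R _ _ J v hv
  obtain ⟨n, h1, h2⟩ := gen_inv (isGen_gen g)
  have h3 : aeval (act n v) D ∈ J ^ 10 := by
    apply h R J
    intro i j
    have hβ : β = act n (act (gen g) β) := by rw [act_act, h1, act_one]
    have : β j • act n v i - β i • act n v j =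
        ∑ k, ∑ l, (n i k * n j l) • (act (gen g) β l • v k - act (gen g) β k • v l) := by
      conv_lhs => rw [hβ]
      generalize act (gen g) β = b
      simp only [act, Fin.sum_univ_four, smul_eq_mul]
      module
    rw [this]
    exact Submodule.sum_mem _ fun k _ => Submodule.sum_mem _ fun l _ =>
      Submodule.smul_of_tower_mem J _ (hv k l)
  rwa [← hD.apply (isGen_gen g), act_act, h2, act_one] at h3

lemma PB_e4 {D : MvPolynomial (Fin 4) ℝ}
    (hD : D ∈ (Ideal.span {X 0, X 1, X 2} : Ideal (MvPolynomial (Fin 4) ℝ)) ^ 10) :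
    PB D ![0, 0, 0, 1] := by
  intro R _ _ J v hv
  have h1 := Ideal.mem_map_of_mem (aeval v : MvPolynomial (Fin 4) ℝ →ₐ[ℝ] R) hD
  rw [Ideal.map_pow] at h1
  refine Ideal.pow_right_mono ?_ 10 h1
  rw [Ideal.map_span, Ideal.span_le]
  rintro _ ⟨p, hp, rfl⟩
  simp only [Set.mem_insert_iff, Set.mem_singleton_iff] at hp
  rcases hp with rfl | rfl | rfl
  · simpa using hv 0 3
  · simpa using hv 1 3
  · simpa using hv 2 3

/-! ### Finishing steps: many linear forms -/

/-- Coordinates of a `V4`. -/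
def V4.get (v : V4) (k : Fin 4) : ℤ × ℤ :=
  match k with
  | 0 => v.x
  | 1 => v.y
  | 2 => v.z
  | 3 => v.w

lemma V4.toV_apply (v : V4) (k : Fin 4) : v.toV k = toR (v.get k) := by
  fin_cases k <;> rfl

/-- Non-proportionality. -/
def V4.indep (v u : V4) : Bool :=
  decide (zmul v.x u.y ≠ zmul v.y u.x) || decide (zmul v.x u.z ≠ zmul v.z u.x) ||
  decide (zmul v.y u.z ≠ zmul v.z u.y) || decide (zmul v.x u.w ≠ zmul v.w u.x) ||
  decide (zmul v.y u.w ≠ zmul v.w u.y) || decide (zmul v.z u.w ≠ zmul v.w u.z)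

lemma V4.indep_spec {v u : V4} (h : v.indep u = true) :
    ∃ k l, v.toV k * u.toV l ≠ v.toV l * u.toV k := by
  have key : ∀ k l, zmul (v.get k) (u.get l) ≠ zmul (v.get l) (u.get k) →
      v.toV k * u.toV l ≠ v.toV l * u.toV k := by
    intro k l hne
    simp only [V4.toV_apply, ← toR_mul]
    exact fun h => hne (toR_inj h)
  simp only [V4.indep, Bool.or_eq_true, decide_eq_true_eq] at h
  rcases h with ((((h | h) | h) | h) | h) | h
  · exact ⟨0, 1, key 0 1 h⟩
  · exact ⟨0, 2, key 0 2 h⟩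
  · exact ⟨1, 2, key 1 2 h⟩
  · exact ⟨0, 3, key 0 3 h⟩
  · exact ⟨1, 3, key 1 3 h⟩
  · exact ⟨2, 3, key 2 3 h⟩

lemma V4.toV_ne_zero {v : V4} (h : v ≠ ⟨0, 0, 0, 0⟩) : v.toV ≠ 0 := by
  intro h0
  apply h
  have key : ∀ k, v.get k = 0 := by
    intro k
    apply toR_inj
    rw [← V4.toV_apply, h0]
    simp [toR]
  have h1 := key 0
  have h2 := key 1
  have h3 := key 2
  have h4 := key 3
  cases v
  simp only [V4.get] at h1 h2 h3 h4
  rw [h1, h2, h3, h4]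

/-- Words giving 40 of the 60 mirrors of `H4`. -/
def words4 : List (List (Fin 4)) :=
  [[], [3], [2, 3], [0, 2, 3], [1, 2, 3], [3, 2, 3], [1, 0, 2, 3], [2, 0, 2, 3], [3, 0, 2, 3],
   [3, 1, 2, 3], [0, 3, 2, 3], [2, 1, 0, 2, 3], [0, 2, 0, 2, 3], [1, 2, 0, 2, 3],
   [3, 2, 0, 2, 3], [2, 3, 0, 2, 3], [2, 0, 3, 2, 3], [0, 2, 1, 0, 2, 3], [1, 2, 1, 0, 2, 3],
   [3, 2, 1, 0, 2, 3], [1, 0, 2, 0, 2, 3], [3, 0, 2, 0, 2, 3], [3, 1, 2, 0, 2, 3],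
   [0, 3, 2, 0, 2, 3], [2, 3, 2, 0, 2, 3], [0, 2, 3, 0, 2, 3], [1, 2, 3, 0, 2, 3],
   [3, 2, 3, 0, 2, 3], [0, 2, 0, 3, 2, 3], [1, 2, 0, 3, 2, 3], [1, 0, 2, 1, 0, 2, 3],
   [2, 0, 2, 1, 0, 2, 3], [3, 0, 2, 1, 0, 2, 3], [3, 1, 2, 1, 0, 2, 3],
   [0, 3, 2, 1, 0, 2, 3], [2, 3, 2, 1, 0, 2, 3], [2, 1, 0, 2, 0, 2, 3],
   [2, 3, 0, 2, 0, 2, 3], [2, 3, 1, 2, 0, 2, 3], [2, 0, 3, 2, 0, 2, 3]]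

/-- 40 roots of `H4`. -/
def root4 (i : Fin 40) : V4 := zword (words4.getD i []) ⟨0, 0, 0, (1, 0)⟩

lemma root4_ne (i : Fin 40) : root4 i ≠ ⟨0, 0, 0, 0⟩ := by
  revert i; decide +kernel

lemma root4_indep (i j : Fin 40) (h : i ≠ j) : (root4 i).indep (root4 j) = true := by
  revert i j; decide +kernel

lemma step3 {D : MvPolynomial (Fin 4) ℝ} (hD : GInv D) (hh : D.IsHomogeneous 36)
    (h : (X 3 : MvPolynomial (Fin 4) ℝ) ∣ D) : D = 0 := by
  have hid : aeval (X : Fin 4 → MvPolynomial (Fin 4) ℝ) D = D := by simp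
  have hr : ∀ i, lin (root4 i).toV (X : Fin 4 → MvPolynomial (Fin 4) ℝ) ^ 1 ∣ D := by
    intro i
    refine orbit_word (fun β => lin β (X : Fin 4 → MvPolynomial (Fin 4) ℝ) ^ 1 ∣ D) ?_ _ ?_ _ ?_
    · intro c hc β hβ
      simp only [lin_smul]
      exact smul_pow_dvd hc hβ
    · intro g _ β hβ
      have := dvd_transport hD (X : Fin 4 → MvPolynomial (Fin 4) ℝ) 1 g
        (aeval (act (gen g) X)) (fun i => by simp) β (by rw [hid]; exact hβ)
      rwa [hid] at this
    · simpa [lin, Fin.sum_univ_four, V4.toV, toR] using h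
  refine eq_zero_of_forms_dvd (fun i => (root4 i).toV) (fun _ => 1) D 36 hh.totalDegree_le
    (by simp) (fun i => V4.toV_ne_zero (root4_ne i)) ?_ hr
  intro i j hij
  exact V4.indep_spec (root4_indep i j hij)

/-- The generic point of the hyperplane `w = 0`. -/
noncomputable def v0 : Fin 4 → MvPolynomial (Fin 3) ℝ := ![X 0, X 1, X 2, 0]

lemma v0_transport {D : MvPolynomial (Fin 4) ℝ} (hD : GInv D) (e : ℕ) (g : Fin 4) (hg : g ≠ 3)
    (α : Fin 4 → ℝ) (h : lin α v0 ^ e ∣ aeval v0 D) :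
    lin (act (gen g) α) v0 ^ e ∣ aeval v0 D := by
  refine dvd_transport hD v0 e g (aeval ![act (gen g) v0 0, act (gen g) v0 1, act (gen g) v0 2])
    ?_ α h
  intro i
  fin_cases i
  · change aeval _ (X 0 : MvPolynomial (Fin 3) ℝ) = _
    rw [aeval_X]; rfl
  · change aeval _ (X 1 : MvPolynomial (Fin 3) ℝ) = _
    rw [aeval_X]; rfl
  · change aeval _ (X 2 : MvPolynomial (Fin 3) ℝ) = _
    rw [aeval_X]; rfl
  · have h0 : gen g 3 0 = 0 ∧ gen g 3 1 = 0 ∧ gen g 3 2 = 0 := by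
      fin_cases g
      · exact ⟨rfl, rfl, rfl⟩
      · exact ⟨rfl, rfl, rfl⟩
      · exact ⟨mul_zero _, mul_zero _, mul_zero _⟩
      · exact absurd rfl hg
    change aeval _ (0 : MvPolynomial (Fin 3) ℝ) = ∑ j, gen g 3 j • v0 j
    rw [Fin.sum_univ_four, h0.1, h0.2.1, h0.2.2, map_zero, zero_smul, zero_smul, zero_smul]
    simp [v0]

/-- Words giving the 15 mirrors and the 6 five-fold axes of `H3`. -/
def words3 : List (List (Fin 4)) :=
  [[], [2], [0, 2], [1, 2], [1, 0, 2], [2, 0, 2], [2, 1, 0, 2], [0, 2, 0, 2], [1, 2, 0, 2],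
   [0, 2, 1, 0, 2], [1, 2, 1, 0, 2], [1, 0, 2, 0, 2], [1, 0, 2, 1, 0, 2], [2, 0, 2, 1, 0, 2],
   [2, 1, 0, 2, 0, 2], [], [0], [2, 0], [0, 2, 0], [2, 0, 2, 0], [1, 2, 0, 2, 0]]

/-- The 15 + 6 linear forms. -/
def root3 (i : Fin 21) : V4 :=
  zword (words3.getD i []) (if i < 15 then ⟨(1, 0), 0, 0, 0⟩ else ⟨(0, 1), (1, 0), 0, 0⟩)

/-- Their multiplicities. -/
def mult3 (i : Fin 21) : ℕ := if i < 15 then 1 else 4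

lemma root3_word (i : Fin 21) : ∀ g ∈ words3.getD i [], g ≠ 3 := by
  revert i; decide +kernel

lemma root3_ne (i : Fin 21) : root3 i ≠ ⟨0, 0, 0, 0⟩ := by
  revert i; decide +kernel

lemma root3_w (i : Fin 21) : (root3 i).w = 0 := by
  revert i; decide +kernel

lemma root3_indep (i j : Fin 21) (h : i ≠ j) : (root3 i).indep (root3 j) = true := by
  revert i j; decide +kernel

lemma root3_w' (i : Fin 21) : (root3 i).toV 3 = 0 := by
  rw [V4.toV_apply]
  change toR (root3 i).w = 0
  rw [root3_w]
  simp [toR]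

lemma v0_orbit {D : MvPolynomial (Fin 4) ℝ} (hD : GInv D) (e : ℕ) (w : List (Fin 4))
    (hw : ∀ g ∈ w, g ≠ 3) (v : V4) (h : lin v.toV v0 ^ e ∣ aeval v0 D) :
    lin (zword w v).toV v0 ^ e ∣ aeval v0 D := by
  refine orbit_word (fun β => lin β v0 ^ e ∣ aeval v0 D) ?_ w ?_ v h
  · intro c hc β hβ
    simp only [lin_smul]
    exact smul_pow_dvd hc hβ
  · intro g hg β hβ
    exact v0_transport hD e g (hw g hg) β hβ

lemma v0_hom {D : MvPolynomial (Fin 4) ℝ} (hh : D.IsHomogeneous 36) :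
    (aeval v0 D).IsHomogeneous 36 := by
  have := hh.aeval v0 (n := 1) (fun i => by
    fin_cases i
    · exact isHomogeneous_X _ _
    · exact isHomogeneous_X _ _
    · exact isHomogeneous_X _ _
    · exact isHomogeneous_zero _ _ _)
  simpa using this

lemma step2 {D : MvPolynomial (Fin 4) ℝ} (hD : GInv D) (hh : D.IsHomogeneous 36)
    (h4 : lin ![gr, 1, 0, 0] v0 ^ 4 ∣ aeval v0 D) (h1 : lin ![1, 0, 0, 0] v0 ∣ aeval v0 D) :
    aeval v0 D = 0 := by
  have hr : ∀ i, lin (root3 i).toV v0 ^ mult3 i ∣ aeval v0 D := by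
    intro i
    refine v0_orbit hD _ _ (root3_word i) _ ?_
    unfold mult3
    split_ifs
    · simpa [lin, Fin.sum_univ_four, V4.toV, toR] using h1
    · simpa [lin, Fin.sum_univ_four, V4.toV, toR] using h4
  refine eq_zero_of_forms_dvd (fun (i : Fin 21) (k : Fin 3) => (root3 i).toV k.castSucc) mult3
    _ 36 (v0_hom hh).totalDegree_le (by decide +kernel) ?_ ?_ ?_
  · intro i h0
    apply V4.toV_ne_zero (root3_ne i)
    ext k
    refine Fin.lastCases ?_ (fun k => ?_) k
    · exact root3_w' i
    · exact congrFun h0 k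
  · intro i j hij
    obtain ⟨k, l, h⟩ := V4.indep_spec (root3_indep i j hij)
    have hi := root3_w' i
    have hj := root3_w' j
    induction k using Fin.lastCases with
    | last => exact absurd (by change (root3 i).toV 3 * _ = _ * (root3 j).toV 3; rw [hi, hj]; ring) h
    | cast k =>
      induction l using Fin.lastCases with
      | last => exact absurd (by change _ * (root3 j).toV 3 = (root3 i).toV 3 * _; rw [hi, hj]; ring) h
      | cast l => exact ⟨k, l, h⟩
  · intro i
    have := hr i
    have h5 : lin (root3 i).toV v0 =
        ∑ k : Fin 3, (root3 i).toV k.castSucc • (X k : MvPolynomial (Fin 3) ℝ) := by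
      simp [lin, Fin.sum_univ_four, Fin.sum_univ_three, v0]
    rwa [h5] at this

/-! ### Restriction to the hyperplane `w = 0`: multiplicity along the five-fold planes -/

lemma hom_degree {n N : ℕ} {Q : MvPolynomial (Fin n) ℝ} (hQ : Q.IsHomogeneous N)
    {d : Fin n →₀ ℕ} (hd : coeff d Q ≠ 0) : ∑ i, d i = N := by
  have := hQ hd
  rw [show (1 : Fin n → ℕ) = fun _ => 1 from rfl, ← Finsupp.degree_eq_weight_one] at this
  rwa [Finsupp.degree_eq_sum] at this

lemma PB_affine {D : MvPolynomial (Fin 4) ℝ} {β : Fin 4 → ℝ} (h : PB D β) {R : Type} [CommRing R]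
    [Algebra ℝ R] (J : Ideal R) (v : Fin 4 → R) (hv : ∀ i, v i - algebraMap ℝ R (β i) ∈ J) :
    aeval v D ∈ J ^ 10 := by
  apply h R J v
  intro i j
  have : β j • v i - β i • v j = β j • (v i - algebraMap ℝ R (β i)) -
      β i • (v j - algebraMap ℝ R (β j)) := by
    simp only [Algebra.smul_def]
    ring
  rw [this]
  exact J.sub_mem (Submodule.smul_of_tower_mem J _ (hv i)) (Submodule.smul_of_tower_mem J _ (hv j))

lemma coeff_dvd_of_mem_pow (q : Polynomial ℝ) (n : ℕ) (f : Polynomial (Polynomial ℝ))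
    (hf : f ∈ (Ideal.span {Polynomial.X, Polynomial.C q} : Ideal (Polynomial (Polynomial ℝ))) ^ n)
    (k : ℕ) : q ^ (n - k) ∣ f.coeff k := by
  induction n generalizing f k with
  | zero => simp
  | succ n ih =>
    rw [Submodule.pow_succ] at hf
    refine Submodule.mul_induction_on hf ?_ ?_
    · intro a ha b hb
      obtain ⟨s, t, rfl⟩ := Ideal.mem_span_pair.mp hb
      have h1 := ih (a * s) (Ideal.mul_mem_right _ _ ha)
      have h2 := ih (a * t) (Ideal.mul_mem_right _ _ ha) k
      rw [mul_add, ← mul_assoc, ← mul_assoc, Polynomial.coeff_add, Polynomial.coeff_mul_C]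
      apply dvd_add
      · cases k with
        | zero => simp
        | succ k =>
          rw [Polynomial.coeff_mul_X]
          simpa using h1 k
      · refine (pow_dvd_pow q (show n + 1 - k ≤ (n - k) + 1 by omega)).trans ?_
        rw [pow_succ]
        exact mul_dvd_mul h2 dvd_rfl
    · intro a b ha hb
      rw [Polynomial.coeff_add]
      exact dvd_add ha hb

lemma coeff_dehom (Q : MvPolynomial (Fin 3) ℝ) (k a : ℕ) :
    ((aeval ![Polynomial.C Polynomial.X, Polynomial.X, (1 : Polynomial (Polynomial ℝ))]
      Q).coeff k).coeff a = ∑ d ∈ Q.support, if d 1 = k ∧ d 0 = a then coeff d Q else 0 := by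
  rw [aeval_def, eval₂_eq', Polynomial.finsetSum_coeff, Polynomial.finsetSum_coeff]
  apply Finset.sum_congr rfl
  intro d _
  have : algebraMap ℝ (Polynomial (Polynomial ℝ)) (coeff d Q) *
      ∏ i, (![Polynomial.C Polynomial.X, Polynomial.X, (1 : Polynomial (Polynomial ℝ))] i) ^ d i =
      Polynomial.C (Polynomial.C (coeff d Q) * Polynomial.X ^ d 0) * Polynomial.X ^ d 1 := by
    rw [Fin.prod_univ_three]
    simp only [Matrix.cons_val_zero, Matrix.cons_val_one, Matrix.cons_val, one_pow, mul_one,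
      map_mul, map_pow]
    rw [← mul_assoc]
    rfl
  rw [this, Polynomial.coeff_C_mul_X_pow]
  by_cases h1 : k = d 1
  · by_cases h2 : a = d 0
    · simp [h1, h2]
    · rw [if_pos h1, Polynomial.coeff_C_mul_X_pow, if_neg h2, if_neg]
      exact fun h => h2 h.2.symm
  · rw [if_neg h1, if_neg (fun h => h1 h.1.symm), Polynomial.coeff_zero]

lemma coeff_dehom_natDegree {Q : MvPolynomial (Fin 3) ℝ} (hQ : Q.IsHomogeneous 36) (k : ℕ) :
    ((aeval ![Polynomial.C Polynomial.X, Polynomial.X, (1 : Polynomial (Polynomial ℝ))]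
      Q).coeff k).natDegree ≤ 36 - k := by
  rw [Polynomial.natDegree_le_iff_coeff_eq_zero]
  intro a ha
  rw [coeff_dehom]
  apply Finset.sum_eq_zero
  intro d hd
  have h := hom_degree hQ (mem_support_iff.mp hd)
  rw [Fin.sum_univ_three] at h
  rw [if_neg]
  omega

lemma X_pow_dvd_of_dehom {Q : MvPolynomial (Fin 3) ℝ} (hQ : Q.IsHomogeneous 36) (n : ℕ)
    (h : ∀ k < n, (aeval ![Polynomial.C Polynomial.X, Polynomial.X,
      (1 : Polynomial (Polynomial ℝ))] Q).coeff k = 0) : X 1 ^ n ∣ Q := by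
  have : (X 1 ^ n : MvPolynomial (Fin 3) ℝ) = monomial (Finsupp.single 1 n) 1 := by
    rw [X_pow_eq_monomial]
  rw [this, monomial_one_dvd_iff_modMonomial_eq_zero]
  ext d
  rw [coeff_zero]
  by_cases hd : Finsupp.single 1 n ≤ d
  · exact coeff_modMonomial_of_le _ hd
  · rw [coeff_modMonomial_of_not_le _ hd]
    have hd1 : d 1 < n := by
      by_contra hlt
      apply hd
      rw [Finsupp.single_le_iff]
      omega
    by_contra hne
    have h1 := coeff_dehom Q (d 1) (d 0)
    rw [h _ hd1, Polynomial.coeff_zero, Finset.sum_eq_single d] at h1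
    · simp at h1
      exact hne h1.symm
    · intro c hc hcd
      rw [if_neg]
      rintro ⟨h2, h3⟩
      apply hcd
      have h4 := hom_degree hQ (mem_support_iff.mp hc)
      have h5 := hom_degree hQ hne
      rw [Fin.sum_univ_three] at h4 h5
      ext i
      fin_cases i
      · exact h3
      · exact h2
      · change c 2 = d 2
        omega
    · intro hns
      exact absurd (mem_support_iff.mpr hne) hns

/-- The parameters of five roots in a plane. -/
def pz (i : Fin 5) : ℤ × ℤ :=
  match i with
  | 0 => (0, 0)
  | 1 => (0, 1)
  | 2 => (0, -1)
  | 3 => (2, -1)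
  | 4 => (-2, 1)

lemma pz_inj : Function.Injective pz := by
  unfold Function.Injective
  decide +kernel

/-- Words giving these roots. -/
def pw (i : Fin 5) : List (Fin 4) :=
  match i with
  | 0 => [2, 1, 0, 2, 0, 2, 3]
  | 1 => [1, 0, 2, 0, 2, 3]
  | 2 => [2, 0, 2, 3]
  | 3 => [1, 2, 3]
  | 4 => [0, 2, 3]

/-- The five roots. -/
def pr (i : Fin 5) : V4 := ⟨pz i, zmul (0, -1) (pz i), (1, 0), 0⟩

lemma pr_word (i : Fin 5) : (zword (pw i) ⟨0, 0, 0, (1, 0)⟩).z ≠ 0 ∧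
    (zword (pw i) ⟨0, 0, 0, (1, 0)⟩).scale (1, 0) =
      (pr i).scale (zword (pw i) ⟨0, 0, 0, (1, 0)⟩).z := by
  revert i; decide +kernel

lemma PB_orbit {D : MvPolynomial (Fin 4) ℝ} (hD : GInv D) (h4 : PB D ![0, 0, 0, 1])
    (w : List (Fin 4)) (t : V4) (c d : ℤ × ℤ) (hd : d ≠ 0) (hc : c ≠ 0)
    (h : (zword w ⟨0, 0, 0, (1, 0)⟩).scale d = t.scale c) : PB D t.toV := by
  refine orbit_to (PB D) (PB_smul D) w (fun g _ => PB_act hD g) ⟨0, 0, 0, (1, 0)⟩ t ?_ c d hd hc h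
  have : (V4.toV ⟨0, 0, 0, (1, 0)⟩) = ![0, 0, 0, 1] := by simp [V4.toV, toR]
  rwa [this]

lemma pr_PB {D : MvPolynomial (Fin 4) ℝ} (hD : GInv D) (h4 : PB D ![0, 0, 0, 1]) (i : Fin 5) :
    PB D (pr i).toV :=
  PB_orbit hD h4 (pw i) (pr i) _ (1, 0) (by decide) (pr_word i).1 (pr_word i).2

lemma step1 {D : MvPolynomial (Fin 4) ℝ} (hD : GInv D) (hh : D.IsHomogeneous 36)
    (h4 : PB D ![0, 0, 0, 1]) : lin ![gr, 1, 0, 0] v0 ^ 4 ∣ aeval v0 D := by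
  let vq : Fin 4 → MvPolynomial (Fin 3) ℝ := ![X 0, X 1 - gr • X 0, X 2, 0]
  let Q : MvPolynomial (Fin 3) ℝ := aeval vq D
  have hQ : Q.IsHomogeneous 36 := by
    have := hh.aeval vq (n := 1) (fun i => by
      fin_cases i
      · exact isHomogeneous_X _ _
      · change (X 1 - gr • X 0 : MvPolynomial (Fin 3) ℝ).IsHomogeneous 1
        refine (isHomogeneous_X _ _).sub ?_
        rw [smul_eq_C_mul]
        simpa using (isHomogeneous_C (Fin 3) gr).mul (isHomogeneous_X ℝ (0 : Fin 3))
      · exact isHomogeneous_X _ _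
      · exact isHomogeneous_zero _ _ _)
    rwa [one_mul] at this
  let e := ![Polynomial.C Polynomial.X, Polynomial.X, (1 : Polynomial (Polynomial ℝ))]
  let vG : Fin 4 → Polynomial (Polynomial ℝ) :=
    ![Polynomial.C Polynomial.X, Polynomial.X - gr • Polynomial.C Polynomial.X, 1, 0]
  have hG : aeval e Q = aeval vG D := by
    have : ((aeval e).comp (aeval vq) : MvPolynomial (Fin 4) ℝ →ₐ[ℝ] _) = aeval vG := by
      ext1 i
      simp only [AlgHom.comp_apply, aeval_X]
      fin_cases i <;> simp [vq, e, vG]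
    rw [← this]; rfl
  have hz : ∀ k < 4, (aeval e Q).coeff k = 0 := by
    intro k hk
    refine poly_eq_zero_of_roots (fun i => toR (pz i)) (fun i j h => pz_inj (toR_inj h))
      (fun _ => 10 - k) _ (36 - k) (coeff_dehom_natDegree hQ k) (by simp; omega) ?_
    intro i
    apply coeff_dvd_of_mem_pow
    rw [hG]
    apply PB_affine (pr_PB hD h4 i)
    have hX : Polynomial.X ∈ (Ideal.span {Polynomial.X, Polynomial.C (Polynomial.X -
        Polynomial.C (toR (pz i)))} : Ideal (Polynomial (Polynomial ℝ))) :=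
      Ideal.subset_span (by simp)
    have hY : Polynomial.C (Polynomial.X - Polynomial.C (toR (pz i))) ∈
        (Ideal.span {Polynomial.X, Polynomial.C (Polynomial.X -
        Polynomial.C (toR (pz i)))} : Ideal (Polynomial (Polynomial ℝ))) :=
      Ideal.subset_span (by simp)
    intro j
    fin_cases j
    · convert hY using 1
      simp only [map_sub]
      rfl
    · have h1 := Ideal.sub_mem _ hX (Submodule.smul_of_tower_mem _ gr hY)
      convert h1 using 1
      have h2 : (pr i).toV 1 = - gr * toR (pz i) := by
        change toR (zmul (0, -1) (pz i)) = _
        rw [toR_mul]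
        simp [toR]
      change Polynomial.X - gr • Polynomial.C Polynomial.X -
        algebraMap ℝ (Polynomial (Polynomial ℝ)) ((pr i).toV 1) = _
      rw [h2, map_mul, map_sub, smul_sub, Algebra.smul_def, Algebra.smul_def, map_neg]
      have : algebraMap ℝ (Polynomial (Polynomial ℝ)) (toR (pz i)) =
        Polynomial.C (Polynomial.C (toR (pz i))) := rfl
      rw [this]
      ring
    · have : vG 2 - algebraMap ℝ (Polynomial (Polynomial ℝ)) ((pr i).toV 2) = 0 := by
        have h2 : (pr i).toV 2 = 1 := by
          change toR (1, 0) = 1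
          simp [toR]
        rw [h2, map_one]
        exact sub_self 1
      change vG 2 - algebraMap ℝ (Polynomial (Polynomial ℝ)) ((pr i).toV 2) ∈ _
      rw [this]
      exact Ideal.zero_mem _
    · have : vG 3 - algebraMap ℝ (Polynomial (Polynomial ℝ)) ((pr i).toV 3) = 0 := by
        have h2 : (pr i).toV 3 = 0 := by
          change toR (0, 0) = 0
          simp [toR]
        rw [h2, map_zero]
        exact sub_self 0
      change vG 3 - algebraMap ℝ (Polynomial (Polynomial ℝ)) ((pr i).toV 3) ∈ _
      rw [this]
      exact Ideal.zero_mem _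
  have hdvd := X_pow_dvd_of_dehom hQ 4 hz
  let ψ : MvPolynomial (Fin 3) ℝ →ₐ[ℝ] MvPolynomial (Fin 3) ℝ :=
    aeval ![X 0, gr • X 0 + X 1, X 2]
  have h1 := map_dvd ψ hdvd
  have h2 : ψ Q = aeval v0 D := by
    have : (ψ.comp (aeval vq) : MvPolynomial (Fin 4) ℝ →ₐ[ℝ] _) = aeval v0 := by
      ext1 i
      simp only [AlgHom.comp_apply, aeval_X]
      fin_cases i <;> simp [vq, ψ, v0]
    rw [← this]; rfl
  rw [h2, map_pow] at h1
  convert h1 using 2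
  simp [ψ, lin, v0, Fin.sum_univ_four]

/-! ### Restriction to the plane `x = w = 0` -/

/-- The matrix of a word in the generators. -/
noncomputable def wmat (w : List (Fin 4)) : Matrix (Fin 4) (Fin 4) ℝ :=
  w.foldr (fun g m => gen g * m) 1

lemma act_smul (c : ℝ) (m : Matrix (Fin 4) (Fin 4) ℝ) (v : Fin 4 → ℝ) :
    act m (c • v) = c • act m v := by
  ext i
  simp only [act, Pi.smul_apply, smul_eq_mul, Finset.mul_sum]
  exact Finset.sum_congr rfl fun j _ => by ring

lemma wmat_toV (w : List (Fin 4)) (v : V4) :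
    (zword w v).toV = (2 ^ w.length : ℝ) • act (wmat w) v.toV := by
  induction w with
  | nil => simp [zword, wmat, act_one]
  | cons g w ih =>
    change (zact g (zword w v)).toV = _
    rw [zact_toV, ih, act_smul, act_act, smul_smul, List.length_cons, pow_succ']
    rfl

lemma wmat_inv {D : MvPolynomial (Fin 4) ℝ} (hD : GInv D) (w : List (Fin 4)) {R : Type*}
    [CommRing R] [Algebra ℝ R] (v : Fin 4 → R) : aeval (act (wmat w) v) D = aeval v D := by
  induction w with
  | nil => simp [wmat, act_one]
  | cons g w ih =>
    change aeval (act (gen g * wmat w) v) D = _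
    rw [← act_act, hD.apply (isGen_gen g), ih]

/-- A word exchanging the second and third axes. -/
def swapWord : List (Fin 4) := [2, 0, 2, 1, 0, 2, 3, 2, 1, 0, 2, 0, 2]

lemma swap_col1 : zword swapWord ⟨0, (1, 0), 0, 0⟩ = ⟨0, 0, (-8192, 0), 0⟩ := by decide +kernel

lemma swap_col2 : zword swapWord ⟨0, 0, (1, 0), 0⟩ = ⟨0, (8192, 0), 0, 0⟩ := by decide +kernel

lemma swap_inv {D : MvPolynomial (Fin 4) ℝ} (hD : GInv D) {R : Type*}
    [CommRing R] [Algebra ℝ R] (y z : R) : aeval ![0, z, -y, 0] D = aeval ![0, y, z, 0] D := by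
  rw [← wmat_inv hD swapWord ![0, y, z, 0]]
  congr 2
  have h1 := wmat_toV swapWord ⟨0, (1, 0), 0, 0⟩
  have h2 := wmat_toV swapWord ⟨0, 0, (1, 0), 0⟩
  rw [swap_col1] at h1
  rw [swap_col2] at h2
  have e1 : V4.toV ⟨0, (1, 0), 0, 0⟩ = ![0, 1, 0, 0] := by simp [V4.toV, toR]
  have e2 : V4.toV ⟨0, 0, (1, 0), 0⟩ = ![0, 0, 1, 0] := by simp [V4.toV, toR]
  have e3 : V4.toV ⟨0, 0, (-8192, 0), 0⟩ = ![0, 0, -8192, 0] := by simp [V4.toV, toR]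
  have e4 : V4.toV ⟨0, (8192, 0), 0, 0⟩ = ![0, 8192, 0, 0] := by simp [V4.toV, toR]
  have hl : (2 ^ swapWord.length : ℝ) = 8192 := by norm_num [swapWord]
  rw [e1, e3, hl] at h1
  rw [e2, e4, hl] at h2
  have c1 : ∀ i, act (wmat swapWord) ![0, 1, 0, 0] i = wmat swapWord i 1 := by
    intro i; simp [act, Fin.sum_univ_four]
  have c2 : ∀ i, act (wmat swapWord) ![0, 0, 1, 0] i = wmat swapWord i 2 := by
    intro i; simp [act, Fin.sum_univ_four]
  have k1 : ∀ i, wmat swapWord i 1 = ![0, 0, -1, 0] i := by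
    intro i
    have := congrFun h1 i
    rw [Pi.smul_apply, c1, smul_eq_mul] at this
    fin_cases i <;> simp at this ⊢ <;> linarith
  have k2 : ∀ i, wmat swapWord i 2 = ![0, 1, 0, 0] i := by
    intro i
    have := congrFun h2 i
    rw [Pi.smul_apply, c2, smul_eq_mul] at this
    fin_cases i <;> simp at this ⊢ <;> linarith
  ext i
  have : act (wmat swapWord) ![0, y, z, 0] i =
      wmat swapWord i 1 • y + wmat swapWord i 2 • z := by
    simp [act, Fin.sum_univ_four]
  rw [this, k1, k2]
  fin_cases i <;> simp

lemma hom_smul {n N : ℕ} {Q : MvPolynomial (Fin n) ℝ} (hQ : Q.IsHomogeneous N) (c : ℝ)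
    (x : Fin n → ℝ) : eval (c • x) Q = c ^ N * eval x Q := by
  rw [eval_eq', eval_eq', Finset.mul_sum]
  apply Finset.sum_congr rfl
  intro d hd
  rw [← hom_degree hQ (mem_support_iff.mp hd)]
  simp only [Pi.smul_apply, smul_eq_mul, mul_pow, Finset.prod_mul_distrib, Finset.prod_pow_eq_pow_sum]
  ring

lemma aeval_sub_mem {n : ℕ} {R : Type*} [CommRing R] [Algebra ℝ R] (J : Ideal R) (v u : Fin n → R)
    (h : ∀ i, v i - u i ∈ J) (D : MvPolynomial (Fin n) ℝ) : aeval v D - aeval u D ∈ J := by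
  rw [← Ideal.Quotient.eq]
  have key : ∀ v : Fin n → R, Ideal.Quotient.mk J (aeval v D) =
      aeval (fun i => Ideal.Quotient.mk J (v i)) D := by
    intro v
    have : ((Ideal.Quotient.mkₐ ℝ J).comp (aeval v) : MvPolynomial (Fin n) ℝ →ₐ[ℝ] _) =
      aeval (fun i => Ideal.Quotient.mk J (v i)) := by
      ext i
      simp
    rw [← this]; rfl
  rw [key, key]
  congr 2
  ext i
  exact Ideal.Quotient.eq.mpr (h i)

lemma PB_neg_e2 {D : MvPolynomial (Fin 4) ℝ} (hD : GInv D) (h4 : PB D ![0, 0, 0, 1]) :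
    PB D ![0, -1, 0, 0] := by
  have := PB_orbit hD h4 [3] ⟨0, (-1, 0), 0, 0⟩ (-2, 0) (1, 0) (by decide) (by decide)
    (by decide +kernel)
  have e : V4.toV ⟨0, (-1, 0), 0, 0⟩ = ![0, -1, 0, 0] := by simp [V4.toV, toR]
  rwa [e] at this

lemma PB_e3 {D : MvPolynomial (Fin 4) ℝ} (hD : GInv D) (h4 : PB D ![0, 0, 0, 1]) :
    PB D ![0, 0, 1, 0] := by
  have := pr_PB hD h4 0
  have e : V4.toV (pr 0) = ![0, 0, 1, 0] := by simp [V4.toV, toR, pr, pz, zmul]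
  rwa [e] at this

lemma form_dvd_plane {D : MvPolynomial (Fin 4) ℝ} {α : Fin 4 → ℝ} {e : ℕ}
    (h : lin α v0 ^ e ∣ aeval v0 D) {R : Type*} [CommRing R] [Algebra ℝ R] (y z : R) :
    (α 1 • y + α 2 • z) ^ e ∣ aeval ![0, y, z, 0] D := by
  let τ : MvPolynomial (Fin 3) ℝ →ₐ[ℝ] R := aeval ![0, y, z]
  have h1 := map_dvd τ h
  have h2 : τ (aeval v0 D) = aeval ![0, y, z, 0] D := by
    have : (τ.comp (aeval v0) : MvPolynomial (Fin 4) ℝ →ₐ[ℝ] _) = aeval ![0, y, z, 0] := by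
      ext1 i
      simp only [AlgHom.comp_apply, aeval_X]
      fin_cases i <;> simp [τ, v0]
    rw [← this]; rfl
  have h3 : τ (lin α v0) = α 1 • y + α 2 • z := by
    simp [τ, lin, v0, Fin.sum_univ_four]
  rwa [map_pow, h2, h3] at h1

lemma pow_dvd_of_smul {e : ℕ} {p q : Polynomial ℝ} {c : ℝ} (hc : c ≠ 0) {f : Polynomial ℝ}
    (h : p ^ e ∣ f) (hp : p = c • q) : q ^ e ∣ f := by
  have := smul_pow_dvd (inv_ne_zero hc) h
  rwa [hp, smul_smul, inv_mul_cancel₀ hc, one_smul] at this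

lemma stepU {D : MvPolynomial (Fin 4) ℝ} (hD : GInv D) (hh : D.IsHomogeneous 36)
    (h4 : PB D ![0, 0, 0, 1]) (h0 : eval ![0, 1, 2, 0] D = 0) :
    aeval ![0, Polynomial.X, Polynomial.X + 1, (0 : Polynomial ℝ)] D = 0 := by
  have hs1 := step1 hD hh h4
  have hbase : lin (V4.toV ⟨(0, 1), (1, 0), 0, 0⟩) v0 ^ 4 ∣ aeval v0 D := by
    have e : V4.toV ⟨(0, 1), (1, 0), 0, 0⟩ = ![gr, 1, 0, 0] := by simp [V4.toV, toR]
    rwa [e]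
  have hsm : ∀ c : ℝ, c ≠ 0 → ∀ β, lin β v0 ^ 4 ∣ aeval v0 D → lin (c • β) v0 ^ 4 ∣ aeval v0 D := by
    intro c hc β hβ
    rw [lin_smul]
    exact smul_pow_dvd hc hβ
  have hA : lin ![0, gr, -1, 0] v0 ^ 4 ∣ aeval v0 D := by
    have := orbit_to (fun β => lin β v0 ^ 4 ∣ aeval v0 D) hsm [2, 0, 2, 0]
      (fun g hg => v0_transport hD 4 g (by revert g; decide))
      ⟨(0, 1), (1, 0), 0, 0⟩ ⟨0, (0, 1), (-1, 0), 0⟩ hbase (16, 0) (1, 0) (by decide) (by decide)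
      (by decide +kernel)
    have e : V4.toV ⟨0, (0, 1), (-1, 0), 0⟩ = ![0, gr, -1, 0] := by simp [V4.toV, toR]
    rwa [e] at this
  have hB : lin ![0, gr, 1, 0] v0 ^ 4 ∣ aeval v0 D := by
    have := orbit_to (fun β => lin β v0 ^ 4 ∣ aeval v0 D) hsm [1, 2, 0, 2, 0]
      (fun g hg => v0_transport hD 4 g (by revert g; decide))
      ⟨(0, 1), (1, 0), 0, 0⟩ ⟨0, (0, 1), (1, 0), 0⟩ hbase (-32, 0) (1, 0) (by decide) (by decide)
      (by decide +kernel)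
    have e : V4.toV ⟨0, (0, 1), (1, 0), 0⟩ = ![0, gr, 1, 0] := by simp [V4.toV, toR]
    rwa [e] at this
  have hg2 := gr_sq
  have hg1 : gr - 1 ≠ 0 := by
    intro h
    have : gr = 1 := by linarith
    rw [this] at hg2
    norm_num at hg2
  have hgp : gr + 1 ≠ 0 := by
    intro h
    have : gr = -1 := by linarith
    rw [this] at hg2
    norm_num at hg2
  have hCg : (Polynomial.C gr) ^ 2 = Polynomial.C gr + 1 := by
    rw [← map_pow, hg2, map_add, map_one]
  have hCs : ∀ (a : ℝ) (p : Polynomial ℝ), a • p = Polynomial.C a * p :=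
    fun a p => Polynomial.smul_eq_C_mul a
  have d1 := form_dvd_plane hA (Polynomial.X : Polynomial ℝ) (Polynomial.X + 1)
  have d2 := form_dvd_plane hB (Polynomial.X : Polynomial ℝ) (Polynomial.X + 1)
  have d3 := form_dvd_plane hA (Polynomial.X + 1 : Polynomial ℝ) (-Polynomial.X)
  have d4 := form_dvd_plane hB (Polynomial.X + 1 : Polynomial ℝ) (-Polynomial.X)
  rw [swap_inv hD] at d3 d4
  simp only [Matrix.cons_val_one, Matrix.cons_val_zero, Matrix.cons_val] at d1 d2 d3 d4
  set f := aeval ![0, Polynomial.X, Polynomial.X + 1, (0 : Polynomial ℝ)] D with hf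
  have hdeg : f.natDegree ≤ 36 := by
    have := aeval_natDegree_le D hh.totalDegree_le
      ![0, Polynomial.X, Polynomial.X + 1, (0 : Polynomial ℝ)] (n := 1) (by
        intro i
        fin_cases i
        · simp
        · simp
        · exact (Polynomial.natDegree_X_add_C (1 : ℝ)).le
        · simp)
    simpa using this
  refine poly_eq_zero_of_roots (fun i : Fin 7 => toR (![(0, 0), (-1, 0), (-2, 1), (0, 1), (1, -1),
    (-1, -1), (1, 0)] i)) ?_ ![10, 10, 4, 4, 4, 4, 1] f 36 hdeg (by decide) ?_
  · refine toR_inj.comp ?_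
    unfold Function.Injective
    decide +kernel
  · intro i
    fin_cases i
    · change (Polynomial.X - Polynomial.C (toR (0, 0))) ^ 10 ∣ f
      rw [← Ideal.mem_span_singleton, ← Ideal.span_singleton_pow]
      apply PB_affine (PB_e3 hD h4)
      intro i
      fin_cases i <;> simp [toR]
    · change (Polynomial.X - Polynomial.C (toR (-1, 0))) ^ 10 ∣ f
      rw [← Ideal.mem_span_singleton, ← Ideal.span_singleton_pow]
      apply PB_affine (PB_neg_e2 hD h4)
      intro i
      fin_cases i <;> simp [toR]
    · refine pow_dvd_of_smul (c := gr + 1) hgp d2 ?_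
      change _ = (gr + 1) • (Polynomial.X - Polynomial.C (toR (-2, 1)))
      have : toR (-2, 1) = gr - 2 := by simp [toR]; ring
      rw [this]
      simp only [hCs, map_add, map_sub, map_one, map_ofNat]
      linear_combination hCg
    · refine pow_dvd_of_smul (c := gr - 1) hg1 d1 ?_
      change _ = (gr - 1) • (Polynomial.X - Polynomial.C (toR (0, 1)))
      have : toR (0, 1) = gr := by simp [toR]
      rw [this]
      simp only [hCs, map_add, map_sub, map_one, map_neg]
      linear_combination hCg
    · refine pow_dvd_of_smul (c := gr + 1) hgp d3 ?_
      change _ = (gr + 1) • (Polynomial.X - Polynomial.C (toR (1, -1)))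
      have : toR (1, -1) = 1 - gr := by simp [toR]; ring
      rw [this]
      simp only [hCs, map_add, map_sub, map_one, map_neg]
      linear_combination -hCg
    · refine pow_dvd_of_smul (c := gr - 1) hg1 d4 ?_
      change _ = (gr - 1) • (Polynomial.X - Polynomial.C (toR (-1, -1)))
      have : toR (-1, -1) = -1 - gr := by simp [toR]; ring
      rw [this]
      simp only [hCs, map_add, map_sub, map_one, map_neg]
      linear_combination -hCg
    · change (Polynomial.X - Polynomial.C (toR (1, 0))) ^ 1 ∣ f
      rw [pow_one, Polynomial.dvd_iff_isRoot]
      have e : toR (1, 0) = 1 := by simp [toR]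
      rw [e, Polynomial.IsRoot.def, ← Polynomial.coe_aeval_eq_eval, hf]
      have : ((Polynomial.aeval (1 : ℝ)).comp
          (aeval ![0, Polynomial.X, Polynomial.X + 1, (0 : Polynomial ℝ)]) :
          MvPolynomial (Fin 4) ℝ →ₐ[ℝ] ℝ) = aeval ![0, 1, 2, 0] := by
        ext1 i
        simp only [AlgHom.comp_apply, aeval_X]
        fin_cases i <;> simp
        norm_num
      have h5 := congrArg (fun φ => φ D) this
      simp only [AlgHom.comp_apply] at h5
      rw [h5]
      exact h0

lemma plane_zero {D : MvPolynomial (Fin 4) ℝ} (hh : D.IsHomogeneous 36)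
    (h : aeval ![0, Polynomial.X, Polynomial.X + 1, (0 : Polynomial ℝ)] D = 0) :
    lin ![1, 0, 0, 0] v0 ∣ aeval v0 D := by
  have hev : ∀ t : ℝ, eval ![0, t, t + 1, 0] D = 0 := by
    intro t
    have : ((Polynomial.aeval (t : ℝ)).comp
        (aeval ![0, Polynomial.X, Polynomial.X + 1, (0 : Polynomial ℝ)]) :
        MvPolynomial (Fin 4) ℝ →ₐ[ℝ] ℝ) = aeval ![0, t, t + 1, 0] := by
      ext1 i
      simp only [AlgHom.comp_apply, aeval_X]
      fin_cases i <;> simp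
    have h5 := congrArg (fun φ => φ D) this
    simp only [AlgHom.comp_apply] at h5
    rw [h, map_zero] at h5
    exact h5.symm
  have hz : aeval ![0, X 1, X 2, (0 : MvPolynomial (Fin 3) ℝ)] D = 0 := by
    have hprod : (X 2 - X 1) * aeval ![0, X 1, X 2, (0 : MvPolynomial (Fin 3) ℝ)] D = 0 := by
      apply MvPolynomial.funext
      intro x
      have h6 : eval x (aeval ![0, X 1, X 2, (0 : MvPolynomial (Fin 3) ℝ)] D) =
          eval ![0, x 1, x 2, 0] D := by
        have : ((aeval x).comp (aeval ![0, X 1, X 2, (0 : MvPolynomial (Fin 3) ℝ)]) :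
            MvPolynomial (Fin 4) ℝ →ₐ[ℝ] ℝ) = aeval ![0, x 1, x 2, 0] := by
          ext1 i
          simp only [AlgHom.comp_apply, aeval_X]
          fin_cases i <;> simp
        have h5 := congrArg (fun φ => φ D) this
        simp only [AlgHom.comp_apply] at h5
        exact h5
      rw [map_mul, h6, map_zero, map_sub, eval_X, eval_X]
      by_cases hx : x 2 - x 1 = 0
      · rw [hx, zero_mul]
      · have h7 : ![0, x 1, x 2, 0] = (x 2 - x 1) •
            ![0, x 1 / (x 2 - x 1), x 1 / (x 2 - x 1) + 1, 0] := by
          ext i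
          fin_cases i <;> simp <;> field_simp
          ring
        rw [h7, hom_smul hh, hev, mul_zero, mul_zero]
    rcases mul_eq_zero.mp hprod with h8 | h8
    · exfalso
      have := congrArg (eval (![0, 0, 1] : Fin 3 → ℝ)) h8
      simp at this
    · exact h8
  have h9 := aeval_sub_mem (Ideal.span {(X 0 : MvPolynomial (Fin 3) ℝ)}) v0
    ![0, X 1, X 2, (0 : MvPolynomial (Fin 3) ℝ)] (by
      intro i
      fin_cases i <;> simp [v0]) D
  rw [hz, sub_zero, Ideal.mem_span_singleton] at h9
  simpa [lin, v0, Fin.sum_univ_four] using h9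

theorem unique_aux {D : MvPolynomial (Fin 4) ℝ} (hD : GInv D) (hh : D.IsHomogeneous 36)
    (hI : D ∈ (Ideal.span {X 0, X 1, X 2} : Ideal (MvPolynomial (Fin 4) ℝ)) ^ 10)
    (h0 : eval ![0, 1, 2, 0] D = 0) : D = 0 := by
  have h4 := PB_e4 hI
  have h2 := step2 hD hh (step1 hD hh h4) (plane_zero hh (stepU hD hh h4 h0))
  apply step3 hD hh
  have h9 := aeval_sub_mem (Ideal.span {(X 3 : MvPolynomial (Fin 4) ℝ)}) X
    ![X 0, X 1, X 2, (0 : MvPolynomial (Fin 4) ℝ)] (by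
      intro i
      fin_cases i <;> simp) D
  have h10 : aeval ![X 0, X 1, X 2, (0 : MvPolynomial (Fin 4) ℝ)] D = 0 := by
    have : ((aeval ![X 0, X 1, (X 2 : MvPolynomial (Fin 4) ℝ)]).comp (aeval v0) :
        MvPolynomial (Fin 4) ℝ →ₐ[ℝ] _) = aeval ![X 0, X 1, X 2, 0] := by
      ext1 i
      simp only [AlgHom.comp_apply, aeval_X]
      fin_cases i <;> simp [v0]
    rw [← this, AlgHom.comp_apply, h2, map_zero]
  rw [h10, sub_zero, Ideal.mem_span_singleton] at h9
  simpa using h9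


/-! ### The invariant of degree 36 -/

/-- Half of the vertices of an icosahedron. -/
def ico6 : List V4 :=
  [⟨(0, 1), (1, 0), 0, 0⟩, ⟨(0, 1), (-1, 0), 0, 0⟩, ⟨(1, 0), 0, (0, 1), 0⟩,
   ⟨(-1, 0), 0, (0, 1), 0⟩, ⟨0, (0, 1), (1, 0), 0⟩, ⟨0, (0, 1), (-1, 0), 0⟩]

/-- Half of the vertices of a dodecahedron. -/
def dod10 : List V4 :=
  [⟨(0, 1), 0, (1, -1), 0⟩, ⟨(0, 1), 0, (-1, 1), 0⟩, ⟨0, (-1, 1), (0, 1), 0⟩,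
   ⟨0, (-1, 1), (0, -1), 0⟩, ⟨(-1, 1), (0, 1), 0, 0⟩, ⟨(-1, 1), (0, -1), 0, 0⟩,
   ⟨(1, 0), (1, 0), (1, 0), 0⟩, ⟨(1, 0), (1, 0), (-1, 0), 0⟩, ⟨(1, 0), (-1, 0), (1, 0), 0⟩,
   ⟨(-1, 0), (1, 0), (1, 0), 0⟩]

/-- Half of the roots of type `H3`. -/
def mir15 : List V4 :=
  [⟨(2, 0), 0, 0, 0⟩, ⟨0, (2, 0), 0, 0⟩, ⟨0, 0, (2, 0), 0⟩,
   ⟨(-1, 1), (1, 0), (0, 1), 0⟩, ⟨(1, -1), (1, 0), (0, 1), 0⟩,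
   ⟨(-1, 1), (-1, 0), (0, 1), 0⟩, ⟨(1, -1), (-1, 0), (0, 1), 0⟩,
   ⟨(-1, 0), (0, 1), (-1, 1), 0⟩, ⟨(1, 0), (0, 1), (-1, 1), 0⟩,
   ⟨(-1, 0), (0, -1), (-1, 1), 0⟩, ⟨(1, 0), (0, -1), (-1, 1), 0⟩,
   ⟨(0, -1), (-1, 1), (-1, 0), 0⟩, ⟨(0, 1), (-1, 1), (-1, 0), 0⟩,
   ⟨(0, -1), (1, -1), (-1, 0), 0⟩, ⟨(0, 1), (1, -1), (-1, 0), 0⟩]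

/-- The vectors `u e₄ ± c n`. -/
def shell (u c : ℤ × ℤ) (n : V4) : List V4 :=
  [⟨zmul c n.x, zmul c n.y, zmul c n.z, u⟩,
   ⟨zmul (-c) n.x, zmul (-c) n.y, zmul (-c) n.z, u⟩]

/-- The positive roots of type `H4` (times two). -/
def R60 : List V4 :=
  ⟨0, 0, 0, (2, 0)⟩ :: (ico6.flatMap (shell (0, 1) (-1, 1)) ++
    (ico6.flatMap (shell (-1, 1) (1, 0)) ++ (dod10.flatMap (shell (1, 0) (1, 0)) ++ mir15)))

/-- All roots of type `H4` (times two). -/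
def R120 : List V4 := R60 ++ R60.map (V4.scale (-1, 0))

lemma R120_perm (g : Fin 4) : (R120.map (zact g)).Perm (R120.map (V4.scale (2, 0))) := by
  revert g
  decide +kernel

/-- Power sums of the roots. -/
noncomputable def Spow {R : Type*} [CommRing R] [Algebra ℝ R] (k : ℕ) (v : Fin 4 → R) : R :=
  (R120.map (fun r => lin r.toV v ^ k)).sum

/-- The quadratic invariant. -/
def r2 {R : Type*} [CommRing R] (v : Fin 4 → R) : R :=
  v 0 ^ 2 + v 1 ^ 2 + v 2 ^ 2 + v 3 ^ 2

/-- The invariant of degree 36, as a function. -/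
noncomputable def Fval {R : Type*} [CommRing R] [Algebra ℝ R] (v : Fin 4 → R) : R :=
  19076455529004540637680 * r2 v ^ 18 + (-1249915911317122140) * (r2 v ^ 12 * Spow 12 v) +
  379821950347140 * (r2 v ^ 8 * Spow 20 v) + (-1766286516400) * (r2 v ^ 6 * Spow 24 v) +
  796493168 * (r2 v ^ 3 * Spow 30 v) + (-39494455) * (r2 v ^ 2 * Spow 32 v) +
  65780 * Spow 36 v

/-- The invariant of degree 36. -/
noncomputable def F36 : MvPolynomial (Fin 4) ℝ := Fval X

lemma lin_algHom {R S : Type*} [CommRing R] [Algebra ℝ R] [CommRing S] [Algebra ℝ S]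
    (σ : R →ₐ[ℝ] S) (α : Fin 4 → ℝ) (v : Fin 4 → R) :
    σ (lin α v) = lin α (fun i => σ (v i)) := by
  simp [lin]

lemma Spow_algHom {R S : Type*} [CommRing R] [Algebra ℝ R] [CommRing S] [Algebra ℝ S]
    (σ : R →ₐ[ℝ] S) (k : ℕ) (v : Fin 4 → R) :
    σ (Spow k v) = Spow k (fun i => σ (v i)) := by
  unfold Spow
  rw [map_list_sum, List.map_map]
  congr 1
  apply List.map_congr_left
  intro r _
  simp only [Function.comp, map_pow, lin_algHom]

lemma Fval_algHom {R S : Type*} [CommRing R] [Algebra ℝ R] [CommRing S] [Algebra ℝ S]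
    (σ : R →ₐ[ℝ] S) (v : Fin 4 → R) :
    σ (Fval v) = Fval (fun i => σ (v i)) := by
  unfold Fval
  simp only [map_add, map_mul, map_neg, map_ofNat, map_pow, Spow_algHom, r2]

lemma aeval_F36 {R : Type*} [CommRing R] [Algebra ℝ R] (v : Fin 4 → R) :
    aeval v F36 = Fval v := by
  unfold F36
  rw [Fval_algHom]
  simp

lemma gen_tr (g : Fin 4) : (gen g)ᵀ = gen g ∨ (gen g)ᵀ = - gen g := by
  fin_cases g
  · exact Or.inl m1_tr
  · exact Or.inl m2_tr
  · exact Or.inl m3_tr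
  · exact Or.inr m4_tr

lemma list_smul_sum {R : Type*} [CommRing R] [Algebra ℝ R] (c : ℝ) (f : V4 → R) (l : List V4) :
    (l.map (fun x => c • f x)).sum = c • (l.map f).sum := by
  induction l with
  | nil => simp
  | cons a l ih => simp [ih]

lemma Spow_act {R : Type*} [CommRing R] [Algebra ℝ R] (k : ℕ) (hk : Even k) (g : Fin 4)
    (v : Fin 4 → R) : Spow k (act (gen g) v) = Spow k v := by
  have h1 : ∀ r : V4, lin r.toV (act (gen g) v) ^ k = lin (act (gen g) r.toV) v ^ k := by
    intro r
    rw [lin_act]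
    rcases gen_tr g with h | h
    · rw [h]
    · rw [h]
      have : act (-gen g) r.toV = (-1 : ℝ) • act (gen g) r.toV := by
        ext i; simp [act]
      rw [this, lin_smul, neg_one_smul, hk.neg_pow]
  have h2 : ∀ r : V4, lin (zact g r).toV v ^ k = (2 : ℝ) ^ k • lin (act (gen g) r.toV) v ^ k := by
    intro r
    rw [zact_toV, lin_smul, smul_pow]
  have h3 : ∀ r : V4, lin (r.scale (2, 0)).toV v ^ k = (2 : ℝ) ^ k • lin r.toV v ^ k := by
    intro r
    rw [V4.toV_scale, lin_smul, smul_pow]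
    simp [toR]
  have h4 := ((R120_perm g).map (fun r => lin r.toV v ^ k)).sum_eq
  simp only [List.map_map, Function.comp_def, h2, h3, ← h1] at h4
  rw [list_smul_sum, list_smul_sum] at h4
  unfold Spow
  have h5 := congrArg (fun x => ((2 : ℝ) ^ k)⁻¹ • x) h4
  simpa [smul_smul] using h5

lemma r2_act {R : Type*} [CommRing R] [Algebra ℝ R] (g : Fin 4)
    (v : Fin 4 → R) : r2 (act (gen g) v) = r2 v := by
  have hG : (algebraMap ℝ R gr) ^ 2 = algebraMap ℝ R gr + 1 := by
    rw [← map_pow, gr_sq]; simp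
  obtain ⟨h, hh, hh'⟩ : ∃ h : R, algebraMap ℝ R (1 / 2) = h ∧ 2 * h = 1 := by
    refine ⟨_, rfl, ?_⟩
    rw [← map_ofNat (algebraMap ℝ R) 2, ← map_mul]; norm_num
  fin_cases g
  · change r2 (act m1 v) = r2 v
    simp only [r2, act, Fin.sum_univ_four, m1, Matrix.cons_val]
    simp
  · change r2 (act m2 v) = r2 v
    simp only [r2, act, Fin.sum_univ_four, m2, Matrix.cons_val]
    simp
  · change r2 (act m3 v) = r2 v
    have h4 : 4 * h ^ 2 = 1 := by linear_combination (2 * h + 1) * hh'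
    have e0 : act m3 v 0 = h * (algebraMap ℝ R gr * v 0 + (algebraMap ℝ R gr - 1) * v 1 - v 2) := by
      simp [act, m3, Fin.sum_univ_four, Algebra.smul_def, ← hh]
      ring
    have e1 : act m3 v 1 = h * ((algebraMap ℝ R gr - 1) * v 0 + v 1 + algebraMap ℝ R gr * v 2) := by
      simp [act, m3, Fin.sum_univ_four, Algebra.smul_def, ← hh]
      ring
    have e2 : act m3 v 2 = h * (- v 0 + algebraMap ℝ R gr * v 1 + (1 - algebraMap ℝ R gr) * v 2) := by
      simp [act, m3, Fin.sum_univ_four, Algebra.smul_def, ← hh]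
      ring
    have e3 : act m3 v 3 = v 3 := by
      simp [act, m3, Fin.sum_univ_four]
    unfold r2
    rw [e0, e1, e2, e3]
    generalize algebraMap ℝ R gr = G at *
    linear_combination (v 0 ^ 2 + v 1 ^ 2 + v 2 ^ 2) * h4 +
      2 * h ^ 2 * (v 0 ^ 2 + v 1 ^ 2 + v 2 ^ 2 + v 0 * v 1 + v 0 * v 2 - v 1 * v 2) * hG
  · change r2 (act m4 v) = r2 v
    simp only [r2, act, Fin.sum_univ_four, m4, Matrix.cons_val]
    simp
    ring

lemma lin_hom (α : Fin 4 → ℝ) :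
    (lin α (X : Fin 4 → MvPolynomial (Fin 4) ℝ)).IsHomogeneous 1 := by
  unfold lin
  apply IsHomogeneous.sum
  intro i _
  rw [smul_eq_C_mul]
  simpa using (isHomogeneous_C _ (α i)).mul (isHomogeneous_X ℝ i)

lemma list_sum_hom (l : List (MvPolynomial (Fin 4) ℝ)) (n : ℕ)
    (h : ∀ p ∈ l, p.IsHomogeneous n) : l.sum.IsHomogeneous n := by
  induction l with
  | nil => simpa using isHomogeneous_zero _ _ _
  | cons a l ih =>
    rw [List.sum_cons]
    exact (h a (by simp)).add (ih (fun p hp => h p (by simp [hp])))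

lemma Spow_hom (k : ℕ) : (Spow k (X : Fin 4 → MvPolynomial (Fin 4) ℝ)).IsHomogeneous k := by
  apply list_sum_hom
  intro p hp
  rw [List.mem_map] at hp
  obtain ⟨r, _, rfl⟩ := hp
  simpa using (lin_hom r.toV).pow k

lemma r2_hom : (r2 (X : Fin 4 → MvPolynomial (Fin 4) ℝ)).IsHomogeneous 2 := by
  have h : ∀ i : Fin 4, ((X i : MvPolynomial (Fin 4) ℝ) ^ 2).IsHomogeneous 2 := fun i => by
    simpa using (isHomogeneous_X ℝ i).pow 2
  exact (((h 0).add (h 1)).add (h 2)).add (h 3)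

lemma const_mul_hom (c : ℝ) (p : MvPolynomial (Fin 4) ℝ) (n : ℕ) (h : p.IsHomogeneous n) :
    (C c * p).IsHomogeneous n := by
  simpa using (isHomogeneous_C _ c).mul h

lemma F36_eq : F36 = C 19076455529004540637680 * r2 X ^ 18 +
    C (-1249915911317122140) * (r2 X ^ 12 * Spow 12 X) +
    C 379821950347140 * (r2 X ^ 8 * Spow 20 X) + C (-1766286516400) * (r2 X ^ 6 * Spow 24 X) +
    C 796493168 * (r2 X ^ 3 * Spow 30 X) + C (-39494455) * (r2 X ^ 2 * Spow 32 X) +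
    C 65780 * Spow 36 X := by
  simp only [F36, Fval, map_neg, map_ofNat]

lemma F36_hom : F36.IsHomogeneous 36 := by
  rw [F36_eq]
  refine (((((IsHomogeneous.add ?_ ?_).add ?_).add ?_).add ?_).add ?_).add ?_
  · exact const_mul_hom _ _ _ (r2_hom.pow 18)
  · exact const_mul_hom _ _ _ ((r2_hom.pow 12).mul (Spow_hom 12))
  · exact const_mul_hom _ _ _ ((r2_hom.pow 8).mul (Spow_hom 20))
  · exact const_mul_hom _ _ _ ((r2_hom.pow 6).mul (Spow_hom 24))
  · exact const_mul_hom _ _ _ ((r2_hom.pow 3).mul (Spow_hom 30))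
  · exact const_mul_hom _ _ _ ((r2_hom.pow 2).mul (Spow_hom 32))
  · exact const_mul_hom _ _ _ (Spow_hom 36)

lemma F36_GInv : GInv F36 := by
  have key : ∀ g : Fin 4, aeval (act (gen g) X) F36 = F36 := by
    intro g
    rw [aeval_F36]
    unfold F36 Fval
    rw [r2_act, Spow_act 12 (by decide), Spow_act 20 (by decide), Spow_act 24 (by decide),
      Spow_act 30 (by decide), Spow_act 32 (by decide), Spow_act 36 (by decide)]
  intro m hm
  rcases hm with rfl | rfl | rfl | rfl
  · exact key 0
  · exact key 1
  · exact key 2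
  · exact key 3

/-- Powers in `ℤ[φ]`. -/
def zpw (a : ℤ × ℤ) : ℕ → ℤ × ℤ
  | 0 => (1, 0)
  | n + 1 => zmul a (zpw a n)

lemma toR_pow (a : ℤ × ℤ) (n : ℕ) : toR (zpw a n) = toR a ^ n := by
  induction n with
  | zero => simp [zpw, toR]
  | succ n ih => rw [zpw, toR_mul, ih, pow_succ']

lemma toR_list (f : V4 → ℤ × ℤ) (l : List V4) :
    (l.map (fun r => toR (f r))).sum = toR ((l.map f).sum) := by
  induction l with
  | nil => simp [toR]
  | cons a l ih => simp [ih, toR_add]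

/-- Value at the point `(0,1,2,0)`. -/
def zval (r : V4) : ℤ × ℤ := r.y + zmul (2, 0) r.z

lemma Spow_val (k : ℕ) :
    Spow k (![0, 1, 2, 0] : Fin 4 → ℝ) = toR ((R120.map (fun r => zpw (zval r) k)).sum) := by
  rw [← toR_list]
  unfold Spow
  congr 1
  apply List.map_congr_left
  intro r _
  rw [toR_pow]
  congr 1
  simp [lin, Fin.sum_univ_four, V4.toV, zval, toR_add, toR_mul]
  simp [toR]
  ring

lemma F36_val : eval ![0, 1, 2, 0] F36 = -24644873027174400000 := by
  have h := aeval_F36 (![0, 1, 2, 0] : Fin 4 → ℝ)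
  have hr : r2 (![0, 1, 2, 0] : Fin 4 → ℝ) = 5 := by
    simp [r2]; norm_num
  have h12 : (R120.map (fun r => zpw (zval r) 12)).sum = (247157400, 0) := by decide +kernel
  have h20 : (R120.map (fun r => zpw (zval r) 20)).sum = (18889405275600, 0) := by decide +kernel
  have h24 : (R120.map (fun r => zpw (zval r) 24)).sum = (5600663017104600, 0) := by decide +kernel
  have h30 : (R120.map (fun r => zpw (zval r) 30)).sum = (29823611015880075000, 0) := by decide +kernel
  have h32 : (R120.map (fun r => zpw (zval r) 32)).sum = (524766574843139792400, 0) := by decide +kernel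
  have h36 : (R120.map (fun r => zpw (zval r) 36)).sum = (163773563034112121055000, 0) := by decide +kernel
  unfold Fval at h
  rw [hr, Spow_val, h12, Spow_val, h20, Spow_val, h24, Spow_val, h30, Spow_val, h32, Spow_val, h36] at h
  simp only [toR] at h
  push_cast at h
  refine Eq.trans h ?_
  norm_num

/-! ### Order of vanishing of the invariant -/

lemma pair_sum {R : Type*} [CommRing R] (u L : R) (hL : L ^ 10 = 0) (k : ℕ) (hk : 10 ≤ k) :
    (u + L) ^ k + (u + -L) ^ k = 2 * ∑ i ∈ Finset.range 5,
      (k.choose (2 * i) : R) * u ^ (k - 2 * i) * L ^ (2 * i) := by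
  have key : ∀ M : R, M ^ 10 = 0 → (u + M) ^ k = ∑ m ∈ Finset.range 10,
      M ^ m * u ^ (k - m) * (k.choose m : R) := by
    intro M hM
    rw [add_comm, add_pow]
    symm
    apply Finset.sum_subset
    · intro i hi
      simp only [Finset.mem_range] at *
      omega
    · intro i _ hi
      simp only [Finset.mem_range] at *
      have : M ^ i = 0 := by
        rw [show i = 10 + (i - 10) by omega, pow_add, hM, zero_mul]
      rw [this]; ring
  rw [key L hL, key (-L) (by rw [Even.neg_pow (by decide), hL])]
  simp only [Finset.sum_range_succ, Finset.sum_range_zero]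
  norm_num
  ring

/-- Power sum over a list of vectors. -/
noncomputable def pws {R : Type*} [CommRing R] [Algebra ℝ R] (l : List V4) (j : ℕ)
    (v : Fin 4 → R) : R := (l.map (fun r => lin r.toV v ^ j)).sum

lemma lin_toV {R : Type*} [CommRing R] [Algebra ℝ R] (r : V4) (v : Fin 4 → R) :
    lin r.toV v = algebraMap ℝ R (toR r.x) * v 0 + algebraMap ℝ R (toR r.y) * v 1 +
      algebraMap ℝ R (toR r.z) * v 2 + algebraMap ℝ R (toR r.w) * v 3 := by
  simp [lin, Fin.sum_univ_four, V4.toV, Algebra.smul_def]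

lemma toR_neg (a : ℤ × ℤ) : toR (-a) = - toR a := by
  simp [toR]; ring

lemma toR_zero : toR 0 = 0 := by simp [toR]

lemma pws_nil {R : Type*} [CommRing R] [Algebra ℝ R] (j : ℕ) (v : Fin 4 → R) :
    pws [] j v = 0 := rfl

lemma pws_cons {R : Type*} [CommRing R] [Algebra ℝ R] (a : V4) (l : List V4) (j : ℕ)
    (v : Fin 4 → R) : pws (a :: l) j v = lin a.toV v ^ j + pws l j v := by
  simp [pws]

lemma pws_append {R : Type*} [CommRing R] [Algebra ℝ R] (l l' : List V4) (j : ℕ)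
    (v : Fin 4 → R) : pws (l ++ l') j v = pws l j v + pws l' j v := by
  simp [pws]

lemma pws_shell {R : Type*} [CommRing R] [Algebra ℝ R] (v : Fin 4 → R)
    (hv : ∀ r : V4, r.w = 0 → lin r.toV v ^ 10 = 0) (u c : ℤ × ℤ) (k : ℕ) (hk : 10 ≤ k)
    (l : List V4) (hl : ∀ r ∈ l, r.w = 0) :
    pws (l.flatMap (shell u c)) k v = 2 * ∑ i ∈ Finset.range 5, (k.choose (2 * i) : R) *
      (algebraMap ℝ R (toR u) * v 3) ^ (k - 2 * i) *
      (algebraMap ℝ R (toR c) ^ (2 * i) * pws l (2 * i) v) := by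
  induction l with
  | nil => simp [pws_nil]
  | cons r l ih =>
    have hr : r.w = 0 := hl r (by simp)
    have h0 := hv r hr
    rw [List.flatMap_cons, pws_append, ih (fun r hr => hl r (by simp [hr]))]
    have e1 : pws (shell u c r) k v =
        (algebraMap ℝ R (toR u) * v 3 + algebraMap ℝ R (toR c) * lin r.toV v) ^ k +
        (algebraMap ℝ R (toR u) * v 3 + -(algebraMap ℝ R (toR c) * lin r.toV v)) ^ k := by
      simp only [shell, pws_cons, pws_nil, lin_toV, toR_mul, toR_neg, hr, toR_zero, map_zero,
        map_mul, map_neg]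
      ring
    rw [e1, pair_sum _ _ (by rw [mul_pow, h0, mul_zero]) k hk, ← mul_add,
      ← Finset.sum_add_distrib]
    congr 1
    apply Finset.sum_congr rfl
    intro i _
    rw [pws_cons]
    ring

/-- The coefficient `φ^(k-j) (φ-1)^j + (φ-1)^(k-j)`. -/
def zE (k j : ℕ) : ℤ × ℤ := zmul (zpw (0, 1) (k - j)) (zpw (-1, 1) j) + zpw (-1, 1) (k - j)

lemma algebraMap_toR {R : Type*} [CommRing R] [Algebra ℝ R] (a : ℤ × ℤ) :
    algebraMap ℝ R (toR a) = a.1 + a.2 * algebraMap ℝ R gr := by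
  simp [toR]

lemma E_mul {R : Type*} [CommRing R] [Algebra ℝ R] (k j : ℕ) (a b N : ℤ)
    (h : zmul (zE k j) (a, b) = (N, 0)) :
    (algebraMap ℝ R gr ^ (k - j) * (algebraMap ℝ R gr - 1) ^ j +
      (algebraMap ℝ R gr - 1) ^ (k - j)) * (a + b * algebraMap ℝ R gr) = N := by
  have h1 := congrArg (fun x => algebraMap ℝ R (toR x)) h
  simp only [toR_mul, zE, toR_add, toR_pow, map_mul, map_add, map_pow] at h1
  simp only [algebraMap_toR] at h1
  push_cast at h1
  linear_combination h1

lemma R60_sum {R : Type*} [CommRing R] [Algebra ℝ R] (v : Fin 4 → R)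
    (hv : ∀ r : V4, r.w = 0 → lin r.toV v ^ 10 = 0) (k : ℕ) (hk : 10 ≤ k) :
    pws R60 k v = (2 * v 3) ^ k + 2 * ∑ i ∈ Finset.range 5, (k.choose (2 * i) : R) *
      v 3 ^ (k - 2 * i) * ((algebraMap ℝ R gr ^ (k - 2 * i) * (algebraMap ℝ R gr - 1) ^ (2 * i) +
      (algebraMap ℝ R gr - 1) ^ (k - 2 * i)) * pws ico6 (2 * i) v + pws dod10 (2 * i) v) := by
  have hm : pws mir15 k v = 0 := by
    unfold pws
    apply List.sum_eq_zero
    intro x hx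
    rw [List.mem_map] at hx
    obtain ⟨r, hr, rfl⟩ := hx
    have hw : ∀ r ∈ mir15, r.w = 0 := by decide
    rw [show k = 10 + (k - 10) by omega, pow_add, hv r (hw r hr), zero_mul]
  rw [R60, pws_cons, pws_append, pws_append, pws_append, hm,
    pws_shell v hv _ _ k hk ico6 (by decide), pws_shell v hv _ _ k hk ico6 (by decide),
    pws_shell v hv _ _ k hk dod10 (by decide), add_zero, ← mul_add, ← mul_add,
    ← Finset.sum_add_distrib, ← Finset.sum_add_distrib]
  congr 1
  · rw [lin_toV]
    simp [algebraMap_toR]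
  · congr 1
    apply Finset.sum_congr rfl
    intro i _
    simp only [algebraMap_toR, mul_pow]
    push_cast
    ring

lemma Spow_eq {R : Type*} [CommRing R] [Algebra ℝ R] (v : Fin 4 → R) (k : ℕ) (hk : Even k) :
    Spow k v = 2 * pws R60 k v := by
  have h : ∀ r : V4, lin (r.scale (-1, 0)).toV v ^ k = lin r.toV v ^ k := by
    intro r
    rw [V4.toV_scale, lin_smul]
    simp [toR, hk.neg_pow]
  unfold Spow pws R120
  rw [List.map_append, List.sum_append, List.map_map]
  simp only [Function.comp_def, h]
  ring

lemma psums {R : Type*} [CommRing R] [Algebra ℝ R] (v : Fin 4 → R) (G s t : R)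
    (hG : G = algebraMap ℝ R gr) (hs : s = v 0 ^ 2 + v 1 ^ 2 + v 2 ^ 2)
    (ht : t = (7 - 4 * G) * pws ico6 6 v) :
    pws ico6 0 v = 6 ∧ pws ico6 2 v * 15 = (60 + 30 * G) * s ∧
    pws ico6 4 v * 15 = (90 + 90 * G) * s ^ 2 ∧ pws ico6 6 v * 15 = (9 + 12 * G) * t ∧
    pws ico6 8 v * 15 = (-700 + -1050 * G) * s ^ 4 + (56 + 84 * G) * (s * t) ∧
    pws dod10 0 v = 10 ∧ pws dod10 2 v = 10 * s ∧ pws dod10 4 v = 18 * s ^ 2 ∧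
    pws dod10 6 v = 60 * s ^ 3 - t ∧ pws dod10 8 v * 5 = 1050 * s ^ 4 - 28 * (s * t) := by
  have g2 : G ^ 2 = G + 1 := by rw [hG, ← map_pow, gr_sq]; simp
  have g3 : G ^ 3 = 2 * G + 1 := by linear_combination (G + 1) * g2
  have g4 : G ^ 4 = 3 * G + 2 := by linear_combination G * g3 + 2 * g2
  have g5 : G ^ 5 = 5 * G + 3 := by linear_combination G * g4 + 3 * g2
  have g6 : G ^ 6 = 8 * G + 5 := by linear_combination G * g5 + 5 * g2
  have g7 : G ^ 7 = 13 * G + 8 := by linear_combination G * g6 + 8 * g2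
  have g8 : G ^ 8 = 21 * G + 13 := by linear_combination G * g7 + 13 * g2
  simp only [pws, ico6, dod10, List.map_cons, List.map_nil, List.sum_cons, List.sum_nil,
    lin_toV, algebraMap_toR, ← hG] at ht ⊢
  simp only [Prod.fst_zero, Prod.snd_zero, Int.cast_zero, Int.cast_one, Int.cast_neg, zero_mul,
    one_mul, zero_add, add_zero, neg_mul] at ht ⊢
  generalize v 0 = x at *
  generalize v 1 = y at *
  generalize v 2 = z at *
  subst ht hs
  clear hG
  refine ⟨?_, ?_, ?_, ?_, ?_, ?_, ?_, ?_, ?_, ?_⟩ <;> ring_nf <;>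
    (try simp only [g2, g3, g4, g5, g6, g7, g8]) <;> (try ring)

lemma H_gen {R : Type*} [CommRing R] [Algebra ℝ R] (v : Fin 4 → R)
    (hv : ∀ r : V4, r.w = 0 → lin r.toV v ^ 10 = 0) (s t : R)
    (hs : s = v 0 ^ 2 + v 1 ^ 2 + v 2 ^ 2)
    (ht : t = (7 - 4 * algebraMap ℝ R gr) * pws ico6 6 v) (k : ℕ) (hk : 10 ≤ k) (he : Even k)
    (N0 N2 N4 N6 N8 N9 : ℤ) (c2 c4 c6 c8 : ℕ)
    (h0 : zmul (zE k 0) (90, 0) = (N0, 0)) (h2 : zmul (zE k 2) (60, 30) = (N2, 0))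
    (h4 : zmul (zE k 4) (90, 90) = (N4, 0)) (h6 : zmul (zE k 6) (9, 12) = (N6, 0))
    (h8 : zmul (zE k 8) (-700, -1050) = (N8, 0)) (h9 : zmul (zE k 8) (56, 84) = (N9, 0))
    (e2 : k.choose 2 = c2) (e4 : k.choose 4 = c4) (e6 : k.choose 6 = c6) (e8 : k.choose 8 = c8) :
    Spow k v * 15 = 2 * (15 * (2 * v 3) ^ k + 2 * (v 3 ^ k * (N0 + 150) +
      c2 * v 3 ^ (k - 2) * ((N2 + 150) * s) + c4 * v 3 ^ (k - 4) * ((N4 + 270) * s ^ 2) +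
      c6 * v 3 ^ (k - 6) * (900 * s ^ 3 + (N6 - 15) * t) +
      c8 * v 3 ^ (k - 8) * ((N8 + 3150) * s ^ 4 + (N9 - 84) * (s * t)))) := by
  obtain ⟨p0, p2, p4, p6, p8, d0, d2, d4, d6, d8⟩ := psums v _ s t rfl hs ht
  have h0 := E_mul (R := R) _ _ _ _ _ h0
  have h2 := E_mul (R := R) _ _ _ _ _ h2
  have h4 := E_mul (R := R) _ _ _ _ _ h4
  have h6 := E_mul (R := R) _ _ _ _ _ h6
  have h8 := E_mul (R := R) _ _ _ _ _ h8
  have h9 := E_mul (R := R) _ _ _ _ _ h9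
  rw [Spow_eq v k he, R60_sum v hv k hk]
  simp only [Finset.sum_range_succ, Finset.sum_range_zero, zero_add, mul_zero, mul_one,
    Nat.reduceMul, Nat.choose_zero_right, e2, e4, e6, e8, Nat.cast_one, one_mul, Nat.sub_zero,
    pow_zero]
  simp only [Nat.sub_zero, pow_zero, mul_one] at h0
  push_cast at h0 h2 h4 h6 h8 h9
  generalize algebraMap ℝ R gr = G at *
  generalize v 3 = w at *
  have q0 : (G ^ k + (G - 1) ^ k) * pws ico6 0 v * 15 = N0 := by
    rw [p0]; linear_combination h0
  have q2 : (G ^ (k - 2) * (G - 1) ^ 2 + (G - 1) ^ (k - 2)) * pws ico6 2 v * 15 = N2 * s := by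
    linear_combination (G ^ (k - 2) * (G - 1) ^ 2 + (G - 1) ^ (k - 2)) * p2 + s * h2
  have q4 : (G ^ (k - 4) * (G - 1) ^ 4 + (G - 1) ^ (k - 4)) * pws ico6 4 v * 15 = N4 * s ^ 2 := by
    linear_combination (G ^ (k - 4) * (G - 1) ^ 4 + (G - 1) ^ (k - 4)) * p4 + s ^ 2 * h4
  have q6 : (G ^ (k - 6) * (G - 1) ^ 6 + (G - 1) ^ (k - 6)) * pws ico6 6 v * 15 = N6 * t := by
    linear_combination (G ^ (k - 6) * (G - 1) ^ 6 + (G - 1) ^ (k - 6)) * p6 + t * h6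
  have q8 : (G ^ (k - 8) * (G - 1) ^ 8 + (G - 1) ^ (k - 8)) * pws ico6 8 v * 15 =
      N8 * s ^ 4 + N9 * (s * t) := by
    linear_combination (G ^ (k - 8) * (G - 1) ^ 8 + (G - 1) ^ (k - 8)) * p8 + s ^ 4 * h8 +
      s * t * h9
  rw [d0, d2, d4, d6]
  generalize (G ^ k + (G - 1) ^ k) * pws ico6 0 v = Q0 at *
  generalize (G ^ (k - 2) * (G - 1) ^ 2 + (G - 1) ^ (k - 2)) * pws ico6 2 v = Q2 at *
  generalize (G ^ (k - 4) * (G - 1) ^ 4 + (G - 1) ^ (k - 4)) * pws ico6 4 v = Q4 at *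
  generalize (G ^ (k - 6) * (G - 1) ^ 6 + (G - 1) ^ (k - 6)) * pws ico6 6 v = Q6 at *
  generalize (G ^ (k - 8) * (G - 1) ^ 8 + (G - 1) ^ (k - 8)) * pws ico6 8 v = Q8 at *
  linear_combination 4 * w ^ k * q0 + 4 * c2 * w ^ (k - 2) * q2 + 4 * c4 * w ^ (k - 4) * q4 +
    4 * c6 * w ^ (k - 6) * q6 + 4 * c8 * w ^ (k - 8) * (q8 + 3 * d8)

lemma Fval_zero {R : Type*} [CommRing R] [Algebra ℝ R] (K : Ideal R) (hK : K ^ 10 = ⊥)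
    (v : Fin 4 → R) (v0 : v 0 ∈ K) (v1 : v 1 ∈ K) (v2 : v 2 ∈ K) : Fval v = 0 := by
  have hmem : ∀ r : V4, r.w = 0 → lin r.toV v ∈ K := by
    intro r hr
    rw [lin_toV, hr, toR_zero, map_zero, zero_mul, add_zero]
    exact K.add_mem (K.add_mem (K.mul_mem_left _ v0) (K.mul_mem_left _ v1)) (K.mul_mem_left _ v2)
  have hzero : ∀ x : R, x ∈ K ^ 10 → x = 0 := by
    intro x hx
    rw [hK] at hx
    exact hx
  have hv : ∀ r : V4, r.w = 0 → lin r.toV v ^ 10 = 0 := fun r hr =>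
    hzero _ (Ideal.pow_mem_pow (hmem r hr) 10)
  obtain ⟨s, hs⟩ : ∃ s, s = v 0 ^ 2 + v 1 ^ 2 + v 2 ^ 2 := ⟨_, rfl⟩
  obtain ⟨t, ht⟩ : ∃ t, t = (7 - 4 * algebraMap ℝ R gr) * pws ico6 6 v := ⟨_, rfl⟩
  have sK : s ∈ K ^ 2 := by
    rw [hs]
    exact add_mem (add_mem (Ideal.pow_mem_pow v0 2) (Ideal.pow_mem_pow v1 2))
      (Ideal.pow_mem_pow v2 2)
  have tK : t ∈ K ^ 6 := by
    rw [ht]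
    apply Ideal.mul_mem_left
    unfold pws
    apply list_sum_mem
    intro x hx
    rw [List.mem_map] at hx
    obtain ⟨r, hr, rfl⟩ := hx
    have hw : ∀ r ∈ ico6, r.w = 0 := by decide
    exact Ideal.pow_mem_pow (hmem r (hw r hr)) 6
  have hs5 : s ^ 5 = 0 := by
    apply hzero
    have := Ideal.pow_mem_pow sK 5
    rwa [← pow_mul] at this
  have hs2t : s ^ 2 * t = 0 := by
    apply hzero
    have := Ideal.mul_mem_mul (Ideal.pow_mem_pow sK 2) tK
    rwa [← pow_mul, ← pow_add] at this
  have h12 := H_gen v hv s t hs ht 12 (by norm_num) (by decide) (28980) (5100) (1620) (30) (-700) (56) 66 495 924 495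
    (by decide +kernel) (by decide +kernel) (by decide +kernel) (by decide +kernel)
    (by decide +kernel) (by decide +kernel) (by decide +kernel) (by decide +kernel)
    (by decide +kernel) (by decide +kernel)
  have h20 := H_gen v hv s t hs ht 20 (by norm_num) (by decide) (1361430) (239550) (75870) (1335) (-16450) (1316) 190 4845 38760 125970
    (by decide +kernel) (by decide +kernel) (by decide +kernel) (by decide +kernel)
    (by decide +kernel) (by decide +kernel) (by decide +kernel) (by decide +kernel)
    (by decide +kernel) (by decide +kernel)
  have h24 := H_gen v hv s t hs ht 24 (by norm_num) (by decide) (9331380) (1641900) (520020) (9150) (-112700) (9016) 276 10626 134596 735471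
    (by decide +kernel) (by decide +kernel) (by decide +kernel) (by decide +kernel)
    (by decide +kernel) (by decide +kernel) (by decide +kernel) (by decide +kernel)
    (by decide +kernel) (by decide +kernel)
  have h30 := H_gen v hv s t hs ht 30 (by norm_num) (by decide) (167444820) (29462700) (9331380) (164190) (-2022300) (161784) 435 27405 593775 5852925
    (by decide +kernel) (by decide +kernel) (by decide +kernel) (by decide +kernel)
    (by decide +kernel) (by decide +kernel) (by decide +kernel) (by decide +kernel)
    (by decide +kernel) (by decide +kernel)
  have h32 := H_gen v hv s t hs ht 32 (by norm_num) (by decide) (438376230) (77134350) (24429870) (429855) (-5294450) (423556) 496 35960 906192 10518300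
    (by decide +kernel) (by decide +kernel) (by decide +kernel) (by decide +kernel)
    (by decide +kernel) (by decide +kernel) (by decide +kernel) (by decide +kernel)
    (by decide +kernel) (by decide +kernel)
  have h36 := H_gen v hv s t hs ht 36 (by norm_num) (by decide) (3004675380) (528686700) (167444820) (2946270) (-36288700) (2903096) 630 58905 1947792 30260340
    (by decide +kernel) (by decide +kernel) (by decide +kernel) (by decide +kernel)
    (by decide +kernel) (by decide +kernel) (by decide +kernel) (by decide +kernel)
    (by decide +kernel) (by decide +kernel)
  simp only [Nat.reduceSub] at h12 h20 h24 h30 h32 h36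
  push_cast at h12 h20 h24 h30 h32 h36
  have hr : r2 v = v 3 ^ 2 + s := by rw [hs, r2]; ring
  have key : Fval v * 15 = 0 := by
    unfold Fval
    rw [hr]
    generalize v 3 = w at *
    generalize Spow 12 v = S12 at *
    generalize Spow 20 v = S20 at *
    generalize Spow 24 v = S24 at *
    generalize Spow 30 v = S30 at *
    generalize Spow 32 v = S32 at *
    generalize Spow 36 v = S36 at *
    linear_combination (-1249915911317122140) * (w ^ 2 + s) ^ 12 * h12 +
      379821950347140 * (w ^ 2 + s) ^ 8 * h20 + (-1766286516400) * (w ^ 2 + s) ^ 6 * h24 +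
      796493168 * (w ^ 2 + s) ^ 3 * h30 + (-39494455) * (w ^ 2 + s) ^ 2 * h32 + 65780 * h36 +
      2 * ((794445370013699094952800) * w ^ 26 +
        (8145724641574565736860400) * w ^ 24 * s ^ 1 +
        (38893881038050138406486400) * w ^ 22 * s ^ 2 +
        (117185691220240860388630800) * w ^ 20 * s ^ 3 +
        (253788772575980474590824000) * w ^ 18 * s ^ 4 +
        (419924293155158465616940800) * w ^ 16 * s ^ 5 +
        (539412084031105614420446400) * w ^ 14 * s ^ 6 +
        (531816515979494674708634400) * w ^ 12 * s ^ 7 +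
        (392749829704999785920680800) * w ^ 10 * s ^ 8 +
        (210429326173178226342006000) * w ^ 8 * s ^ 9 +
        (78288995179008994152513600) * w ^ 6 * s ^ 10 +
        (18858561676633030631167800) * w ^ 4 * s ^ 11 +
        (2575321496415612986086800) * w ^ 2 * s ^ 12 +
        (143073416467534054782600) * s ^ 13) * hs5 +
      2 * ((-39722267612603104452000) * w ^ 26 +
        (-288888649352944235733600) * w ^ 24 * s ^ 1 +
        (-733265177744710869904800) * w ^ 22 * s ^ 2 +
        (-235519236999840001269600) * w ^ 20 * s ^ 3 +
        (2973175449276439405152000) * w ^ 18 * s ^ 4 +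
        (8162215580170320432825600) * w ^ 16 * s ^ 5 +
        (11272367248580095924543200) * w ^ 14 * s ^ 6 +
        (9646001957524426885591200) * w ^ 12 * s ^ 7 +
        (5335741035503436361003200) * w ^ 10 * s ^ 8 +
        (1870974129332373788923200) * w ^ 8 * s ^ 9 +
        (381124359678816882928800) * w ^ 6 * s ^ 10 +
        (34647669061710625720800) * w ^ 4 * s ^ 11) * hs2t
  have h15 : (15 : ℝ)⁻¹ • (Fval v * 15) = Fval v := by
    rw [Algebra.smul_def, mul_comm, mul_assoc, ← map_ofNat (algebraMap ℝ R) 15, ← map_mul]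
    norm_num
  rw [← h15, key, smul_zero]

lemma F36_mem : F36 ∈ (Ideal.span {X 0, X 1, X 2} : Ideal (MvPolynomial (Fin 4) ℝ)) ^ 10 := by
  set I : Ideal (MvPolynomial (Fin 4) ℝ) := Ideal.span {X 0, X 1, X 2} with hI
  rw [← Ideal.Quotient.eq_zero_iff_mem]
  have h := Fval_algHom (Ideal.Quotient.mkₐ ℝ (I ^ 10)) X
  have hx : ∀ i : Fin 4, (X i : MvPolynomial (Fin 4) ℝ) ∈ I →
      Ideal.Quotient.mkₐ ℝ (I ^ 10) (X i) ∈ I.map (Ideal.Quotient.mk (I ^ 10)) :=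
    fun i hi => Ideal.mem_map_of_mem _ hi
  have h2 := Fval_zero (I.map (Ideal.Quotient.mk (I ^ 10)))
    (by rw [← Ideal.map_pow, Ideal.map_quotient_self])
    (fun i => Ideal.Quotient.mkₐ ℝ (I ^ 10) (X i))
    (hx 0 (Ideal.subset_span (by simp))) (hx 1 (Ideal.subset_span (by simp)))
    (hx 2 (Ideal.subset_span (by simp)))
  rw [h2] at h
  exact h

/-- The space of `W(H4)`-invariant homogeneous polynomials of degree 36 lying in
`(x,y,z)^{10}` is one-dimensional: it is spanned by a single nonzero polynomial. -/
theorem WH4_degree36_order10_unique :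
    ∃ F : MvPolynomial (Fin 4) ℝ, F ≠ 0 ∧ F.IsHomogeneous 36 ∧
      (∀ g ∈ WH4, polyActR g F = F) ∧
      F ∈ (Ideal.span {X 0, X 1, X 2} : Ideal (MvPolynomial (Fin 4) ℝ)) ^ 10 ∧
      ∀ F' : MvPolynomial (Fin 4) ℝ, F'.IsHomogeneous 36 →
        (∀ g ∈ WH4, polyActR g F' = F') →
        F' ∈ (Ideal.span {X 0, X 1, X 2} : Ideal (MvPolynomial (Fin 4) ℝ)) ^ 10 →
        ∃ c : ℝ, F' = c • F := by

  have hv : eval ![0, 1, 2, 0] F36 ≠ 0 := by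
    rw [F36_val]; norm_num
  refine ⟨F36, ?_, F36_hom, F36_GInv.invariant, F36_mem, ?_⟩
  · intro h
    rw [h] at hv
    simp at hv
  · intro F' hh hg hm
    refine ⟨eval ![0, 1, 2, 0] F' / eval ![0, 1, 2, 0] F36, ?_⟩
    rw [← sub_eq_zero]
    have hg' := GInv.of_invariant hg
    apply unique_aux
    · intro m hm'
      rw [map_sub, map_smul, hg' m hm', F36_GInv m hm']
    · refine hh.sub ?_
      rw [smul_eq_C_mul]
      exact const_mul_hom _ _ _ F36_hom
    · refine sub_mem hm ?_
      rw [smul_eq_C_mul]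
      exact Ideal.mul_mem_left _ _ F36_mem
    · rw [map_sub, smul_eval, div_mul_cancel₀ _ hv, sub_self]
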